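/- arXiv:2105.10681 — 6 statements merged into one kernel-verified Lean document; each statement's English description precedes it below -/
import Mathlib

section
/- Let X be a real Banach space and let F : [0,1] → (nonempty bounded subsets of X) be a multifunction that is Riemann integrable with Riemann integral A. Then the multifunction conv F : t ↦ conv(F(t)) is also Riemann integrable, and its Riemann integral equals the closed convex hull of A. -/
open Pointwise

/-- A tagged partition of the interval `[0,1]`: subdivision points
`x 0 = 0 ≤ x 1 ≤ … ≤ x n = 1` together with tags `t i ∈ [x i, x (i+1)]`. -/
structure TaggedPartition where
  n : ℕ
  npos : 0 < n
  x : Fin (n + 1) → ℝ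
  t : Fin n → ℝ
  mono : Monotone x
  x_zero : x 0 = 0
  x_last : x (Fin.last n) = 1
  tag_mem : ∀ i : Fin n, t i ∈ Set.Icc (x i.castSucc) (x i.succ)

/-- The mesh `d(T)` of a tagged partition: the largest length of a subinterval. -/
noncomputable def TaggedPartition.mesh (T : TaggedPartition) : ℝ :=
  ⨆ i : Fin T.n, (T.x i.succ - T.x i.castSucc)

/-- The Riemann sum `S(F,T) = ∑ |Δ i| • F (t i)` of a multifunction `F`,
where the sum of sets is the Minkowski sum. -/
noncomputable def setRiemannSum {X : Type*} [NormedAddCommGroup X] [NormedSpace ℝ X]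
    (F : ℝ → Set X) (T : TaggedPartition) : Set X :=
  ∑ i : Fin T.n, (T.x i.succ - T.x i.castSucc) • F (T.t i)

/-- A closed bounded nonempty set `A` is the Riemann integral of the multifunction `F` if
the Riemann sums of `F` converge to `A` in the Hausdorff distance as the mesh tends to `0`. -/
def IsSetRiemannIntegral {X : Type*} [NormedAddCommGroup X] [NormedSpace ℝ X]
    (F : ℝ → Set X) (A : Set X) : Prop :=
  A.Nonempty ∧ IsClosed A ∧ Bornology.IsBounded A ∧
    ∀ ε > 0, ∃ δ > 0, ∀ T : TaggedPartition, T.mesh < δ →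
      Metric.hausdorffDist (setRiemannSum F T) A < ε

/-- A multifunction is Riemann integrable if it has a Riemann integral. -/
def SetRiemannIntegrable {X : Type*} [NormedAddCommGroup X] [NormedSpace ℝ X]
    (F : ℝ → Set X) : Prop :=
  ∃ A : Set X, IsSetRiemannIntegral F A

/-- `F` is a multifunction on `[0,1]` with nonempty bounded values. -/
def IsMultifunction {X : Type*} [NormedAddCommGroup X] (F : ℝ → Set X) : Prop :=
  ∀ t ∈ Set.Icc (0 : ℝ) 1, (F t).Nonempty ∧ Bornology.IsBounded (F t)

theorem nonempty_and_isBounded_finsetSum {ι X : Type*} [NormedAddCommGroup X]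
    (s : Finset ι) (f : ι → Set X) (h : ∀ i ∈ s, (f i).Nonempty ∧ Bornology.IsBounded (f i)) :
    (∑ i ∈ s, f i).Nonempty ∧ Bornology.IsBounded (∑ i ∈ s, f i) :=
  Finset.sum_induction f (fun A => A.Nonempty ∧ Bornology.IsBounded A)
    (fun _ _ hA hB => ⟨hA.1.add hB.1, hA.2.add hB.2⟩)
    ⟨Set.zero_nonempty, Bornology.isBounded_singleton⟩ h

theorem TaggedPartition.tag_mem_Icc (T : TaggedPartition) (i : Fin T.n) :
    T.t i ∈ Set.Icc (0 : ℝ) 1 :=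
  ⟨T.x_zero ▸ (T.mono (Fin.zero_le _)).trans (T.tag_mem i).1,
    T.x_last ▸ (T.tag_mem i).2.trans (T.mono (Fin.le_last _))⟩

section ConvexHullRiemann

variable {X : Type*} [NormedAddCommGroup X] [NormedSpace ℝ X]

theorem setRiemannSum_convexHull (F : ℝ → Set X) (T : TaggedPartition) :
    setRiemannSum (fun t => convexHull ℝ (F t)) T = convexHull ℝ (setRiemannSum F T) := by
  simp only [setRiemannSum, convexHull_sum, convexHull_smul]

theorem convexHull_subset_thickening_convexHull {s t : Set X} {r : ℝ}
    (h : s ⊆ Metric.thickening r t) :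
    convexHull ℝ s ⊆ Metric.thickening r (convexHull ℝ t) :=
  convexHull_min (h.trans (Metric.thickening_subset_of_subset r (subset_convexHull ℝ t)))
    ((convex_convexHull ℝ t).thickening r)

/-- Passing to convex hulls does not increase the Hausdorff distance of bounded sets. -/
theorem hausdorffDist_convexHull_le_hausdorffDist {s t : Set X} (hs : s.Nonempty) (ht : t.Nonempty)
    (bs : Bornology.IsBounded s) (bt : Bornology.IsBounded t) :
    Metric.hausdorffDist (convexHull ℝ s) (convexHull ℝ t) ≤ Metric.hausdorffDist s t := by
  have fin := Metric.hausdorffEDist_ne_top_of_nonempty_of_bounded hs ht bs bt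
  refine le_of_forall_gt_imp_ge_of_dense fun r hr => ?_
  refine Metric.hausdorffDist_le_of_mem_dist (Metric.hausdorffDist_nonneg.trans hr.le) ?_ ?_
  · intro x hx
    have hst : s ⊆ Metric.thickening r t := fun y hy =>
      Metric.mem_thickening_iff.2 (Metric.exists_dist_lt_of_hausdorffDist_lt hy hr fin)
    obtain ⟨z, hz, hxz⟩ :=
      Metric.mem_thickening_iff.1 (convexHull_subset_thickening_convexHull hst hx)
    exact ⟨z, hz, hxz.le⟩
  · intro x hx
    have hts : t ⊆ Metric.thickening r s := fun y hy => by
      obtain ⟨z, hz, hzy⟩ := Metric.exists_dist_lt_of_hausdorffDist_lt' hy hr fin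
      exact Metric.mem_thickening_iff.2 ⟨z, hz, by rwa [dist_comm]⟩
    obtain ⟨z, hz, hxz⟩ :=
      Metric.mem_thickening_iff.1 (convexHull_subset_thickening_convexHull hts hx)
    exact ⟨z, hz, hxz.le⟩

theorem IsMultifunction.nonempty_and_isBounded_setRiemannSum {F : ℝ → Set X}
    (hF : IsMultifunction F) (T : TaggedPartition) :
    (setRiemannSum F T).Nonempty ∧ Bornology.IsBounded (setRiemannSum F T) :=
  nonempty_and_isBounded_finsetSum _ _ fun i _ =>
    have h := hF _ (T.tag_mem_Icc i)
    ⟨h.1.smul_set, h.2.smul₀ _⟩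

end ConvexHullRiemann

/-- If `F` is Riemann integrable with integral `A`, then `conv F` is Riemann integrable
with integral the closed convex hull of `A`. -/
theorem stmt0 {X : Type*} [NormedAddCommGroup X] [NormedSpace ℝ X] [CompleteSpace X]
    (F : ℝ → Set X) (hF : IsMultifunction F) (A : Set X)
    (hFA : IsSetRiemannIntegral F A) :
    IsSetRiemannIntegral (fun t => convexHull ℝ (F t)) (closure (convexHull ℝ A)) := by
  obtain ⟨hne, -, hb, hlim⟩ := hFA
  refine ⟨hne.convexHull.closure, isClosed_closure, (isBounded_convexHull.2 hb).closure,
    fun ε hε => ?_⟩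
  obtain ⟨δ, hδ, h⟩ := hlim ε hε
  refine ⟨δ, hδ, fun T hT => ?_⟩
  rw [setRiemannSum_convexHull, Metric.hausdorffDist_closure₂]
  obtain ⟨hSne, hSb⟩ := hF.nonempty_and_isBounded_setRiemannSum T
  exact (hausdorffDist_convexHull_le_hausdorffDist hSne hne hSb hb).trans_lt (h T hT)
end

section
/- Let p > 1, C > 0, and let X be a real Banach space of infratype p with constant C. Let A_1, …, A_n be bounded nonempty subsets of X with diameters d_i = diam(A_i), and let b_1, …, b_n be points with b_i ∈ conv(A_i) for each i. Then one can choose points a_i ∈ A_i such that ‖Σ_{i=1}^n (a_i − b_i)‖ ≤ C₁ (Σ_{i=1}^n d_i^p)^{1/p}, where C₁ = 2C / (2^{1−1/p} − 1). -/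
open Pointwise

/-- `X` has infratype `p` with constant `C`: for every finite collection of vectors one
can choose signs `±1` so that `‖∑ αᵢ xᵢ‖ ≤ C (∑ ‖xᵢ‖^p)^{1/p}`. -/
def HasInfratype (X : Type*) [NormedAddCommGroup X] [NormedSpace ℝ X] (p C : ℝ) : Prop :=
  ∀ (n : ℕ) (x : Fin n → X), ∃ α : Fin n → ℝ, (∀ i, α i = 1 ∨ α i = -1) ∧
    ‖∑ i, α i • x i‖ ≤ C * (∑ i, ‖x i‖ ^ p) ^ (1 / p)

theorem HasInfratype.exists_signs_fintype {X : Type*} [NormedAddCommGroup X] [NormedSpace ℝ X]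
    {p C : ℝ} (hX : HasInfratype X p C) {ι : Type*} [Fintype ι] (x : ι → X) :
    ∃ α : ι → ℝ, (∀ i, α i = 1 ∨ α i = -1) ∧
      ‖∑ i, α i • x i‖ ≤ C * (∑ i, ‖x i‖ ^ p) ^ (1 / p) := by
  let e := Fintype.equivFin ι
  obtain ⟨α, hα, h⟩ := hX _ (x ∘ e.symm)
  refine ⟨α ∘ e, fun i => hα _, ?_⟩
  have h1 : ∑ i, (α ∘ e) i • x i = ∑ i, α i • (x ∘ e.symm) i :=
    Fintype.sum_equiv e _ _ fun i => by simp
  have h2 : ∑ i, ‖x i‖ ^ p = ∑ i, ‖(x ∘ e.symm) i‖ ^ p :=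
    Fintype.sum_equiv e _ _ fun i => by simp
  rwa [h1, h2]

/-- A family of averages of `2 ^ k` points can be replaced by a selection of one point from each
family, by repeatedly choosing one point from each of a system of pairs. -/
theorem HasInfratype.exists_selection_of_card_eq_two_pow {X : Type*} [NormedAddCommGroup X]
    [NormedSpace ℝ X] {p C : ℝ} (hp : 1 < p) (hC : 0 < C) (hX : HasInfratype X p C)
    {ι : Type*} [Fintype ι] (d : ι → ℝ) (hd : ∀ i, 0 ≤ d i) (k : ℕ) :
    ∀ (σ : Type) [Fintype σ], Fintype.card σ = 2 ^ k → ∀ y : ι → σ → X,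
      (∀ i s t, ‖y i s - y i t‖ ≤ d i) →
      ∃ f : ι → σ, ‖∑ i, (y i (f i) - ((2 : ℝ) ^ k)⁻¹ • ∑ s, y i s)‖ ≤
        C / 2 * (∑ m ∈ Finset.range k, ((2 : ℝ) ^ (1 / p - 1)) ^ m) *
          (∑ i, d i ^ p) ^ (1 / p) := by
  have hp0 : 0 < p := by linarith
  have hD : 0 ≤ ∑ i, d i ^ p := Finset.sum_nonneg fun i _ => Real.rpow_nonneg (hd i) p
  induction k with
  | zero =>
    intro σ _ hσ y _
    obtain ⟨s, hs⟩ := Fintype.card_eq_one_iff.1 (by simpa using hσ)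
    refine ⟨fun _ => s, ?_⟩
    have : (Finset.univ : Finset σ) = {s} := by ext t; simp [hs t]
    simp [this]
  | succ k ih =>
    intro σ _ hσ y hy
    let τ := Fin (2 ^ k)
    have e : τ × Bool ≃ σ := Fintype.equivOfCardEq (by simp [τ, hσ, pow_succ])
    let x : ι × τ → X := fun q =>
      ((2 : ℝ) ^ (k + 1))⁻¹ • (y q.1 (e (q.2, true)) - y q.1 (e (q.2, false)))
    obtain ⟨α, hα, hαx⟩ := hX.exists_signs_fintype x
    let g : ι → τ → σ := fun i s => e (s, decide (α (i, s) = 1))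
    obtain ⟨f, hf⟩ := ih τ (by simp [τ]) (fun i s => y i (g i s)) (fun i s t => hy _ _ _)
    refine ⟨fun i => g i (f i), ?_⟩
    have key : ∀ i s, α (i, s) • x (i, s) = ((2 : ℝ) ^ k)⁻¹ • y i (g i s) -
        ((2 : ℝ) ^ (k + 1))⁻¹ • (y i (e (s, true)) + y i (e (s, false))) := by
      intro i s
      rcases hα (i, s) with h | h
      · have hg : g i s = e (s, true) := by simp [g, h]
        rw [hg, h, pow_succ]
        simp only [x, pow_succ]
        module
      · have hg : g i s = e (s, false) := by simp only [g, h]; norm_num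
        rw [hg, h, pow_succ]
        simp only [x, pow_succ]
        module
    have hsum : ∑ i, (y i (g i (f i)) - ((2 : ℝ) ^ (k + 1))⁻¹ • ∑ s, y i s) =
        ∑ i, (y i (g i (f i)) - ((2 : ℝ) ^ k)⁻¹ • ∑ s, y i (g i s)) + ∑ q, α q • x q := by
      rw [Fintype.sum_prod_type, ← Finset.sum_add_distrib]
      refine Finset.sum_congr rfl fun i _ => ?_
      simp only [key, Finset.sum_sub_distrib, ← Finset.smul_sum]
      rw [← e.sum_comp, Fintype.sum_prod_type]
      simp only [Fintype.sum_bool]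
      abel
    have hx : (∑ q, ‖x q‖ ^ p) ^ (1 / p) ≤
        1 / 2 * ((2 : ℝ) ^ (1 / p - 1)) ^ k * (∑ i, d i ^ p) ^ (1 / p) := by
      have h1 : ∑ q, ‖x q‖ ^ p ≤ (2 : ℝ) ^ k * (((2 : ℝ) ^ (k + 1))⁻¹ ^ p * ∑ i, d i ^ p) := by
        rw [Fintype.sum_prod_type, Finset.mul_sum, Finset.mul_sum]
        refine Finset.sum_le_sum fun i _ => ?_
        calc ∑ s, ‖x (i, s)‖ ^ p ≤ ∑ _s : τ, ((2 : ℝ) ^ (k + 1))⁻¹ ^ p * d i ^ p := by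
              refine Finset.sum_le_sum fun s _ => ?_
              rw [← Real.mul_rpow (by positivity) (hd i)]
              refine Real.rpow_le_rpow (norm_nonneg _) ?_ hp0.le
              simp only [x]
              rw [norm_smul, Real.norm_of_nonneg (by positivity)]
              exact mul_le_mul_of_nonneg_left (hy _ _ _) (by positivity)
          _ = _ := by simp [τ]
      refine (Real.rpow_le_rpow (Finset.sum_nonneg fun q _ => by positivity) h1
        (by positivity)).trans_eq ?_
      rw [Real.mul_rpow (by positivity) (by positivity), Real.mul_rpow (by positivity) hD,
        ← Real.rpow_mul (by positivity), mul_one_div_cancel hp0.ne', Real.rpow_one, ← mul_assoc]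
      congr 1
      have h2 : ((2 : ℝ) ^ k) ^ (1 / p) = ((2 : ℝ) ^ (1 / p)) ^ k := by
        rw [← Real.rpow_natCast, ← Real.rpow_mul two_pos.le, mul_comm, Real.rpow_mul two_pos.le,
          Real.rpow_natCast]
      rw [h2, Real.rpow_sub two_pos, Real.rpow_one, div_pow, pow_succ]
      field_simp
    rw [hsum, Finset.sum_range_succ]
    calc _ ≤ _ := norm_add_le _ _
      _ ≤ _ := add_le_add hf (hαx.trans (mul_le_mul_of_nonneg_left hx hC.le))
      _ = _ := by ring

theorem exists_average_near_of_mem_convexHull {X : Type*} [NormedAddCommGroup X]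
    [NormedSpace ℝ X] {A : Set X} (hA : Bornology.IsBounded A) {b : X}
    (hb : b ∈ convexHull ℝ A) :
    ∃ m : ℕ, ∀ N : ℕ, 0 < N → ∃ y : Fin N → X, (∀ s, y s ∈ A) ∧
      ‖(N : ℝ)⁻¹ • ∑ s, y s - b‖ ≤ m * Metric.diam A / N := by
  obtain ⟨J, _, w, z, hw, hw1, hz, rfl⟩ := mem_convexHull_iff_exists_fintype.1 hb
  classical
  have hJ : Nonempty J := by
    by_contra h
    rw [not_nonempty_iff] at h
    simp at hw1
  obtain ⟨j₀⟩ := hJ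
  refine ⟨Fintype.card J, fun N hN => ?_⟩
  have hN' : (0 : ℝ) < N := by exact_mod_cast hN
  let c : J → ℕ := fun j => ⌊N * w j⌋₊
  have hc : ∀ j, (c j : ℝ) ≤ N * w j := fun j =>
    Nat.floor_le (mul_nonneg hN'.le (hw j))
  have hcN : ∑ j, c j ≤ N := by
    have : ((∑ j, c j : ℕ) : ℝ) ≤ N := by
      push_cast
      refine (Finset.sum_le_sum fun j _ => hc j).trans_eq ?_
      rw [← Finset.mul_sum, hw1, mul_one]
    exact_mod_cast this
  -- the slots left over by rounding down are all filled with `z j₀`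
  let R := N - ∑ j, c j
  have e : (Σ j, Fin (c j)) ⊕ Fin R ≃ Fin N := Fintype.equivOfCardEq (by simp [R]; omega)
  let u : (Σ j, Fin (c j)) ⊕ Fin R → X := Sum.elim (fun q => z q.1) fun _ => z j₀
  refine ⟨fun s => u (e.symm s), fun s => ?_, ?_⟩
  · change u (e.symm s) ∈ A
    generalize e.symm s = q
    rcases q with q | q <;> simp [u, hz]
  have hR : (R : ℝ) = ∑ j, (N * w j - c j) := by
    rw [Finset.sum_sub_distrib, ← Finset.mul_sum, hw1]
    simp [R, Nat.cast_sub hcN]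
  have hs : ∑ s, u (e.symm s) = ∑ j, (c j : ℝ) • z j + (R : ℝ) • z j₀ := by
    rw [e.symm.sum_comp, Fintype.sum_sum_type, Fintype.sum_sigma]
    simp [u, Nat.cast_smul_eq_nsmul]
  have hdiff : (N : ℝ)⁻¹ • ∑ s, u (e.symm s) - ∑ j, w j • z j =
      (N : ℝ)⁻¹ • ∑ j, (N * w j - c j) • (z j₀ - z j) := by
    rw [hs, hR, Finset.sum_smul, ← Finset.sum_add_distrib, Finset.smul_sum, Finset.smul_sum,
      ← Finset.sum_sub_distrib]
    refine Finset.sum_congr rfl fun j _ => ?_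
    match_scalars
    · field_simp
      ring
    · field_simp
  rw [hdiff, norm_smul, norm_inv, Real.norm_of_nonneg hN'.le, div_eq_inv_mul]
  refine mul_le_mul_of_nonneg_left ?_ (by positivity)
  refine (norm_sum_le _ _).trans ?_
  calc ∑ j, ‖(N * w j - c j) • (z j₀ - z j)‖ ≤ ∑ _j : J, Metric.diam A := by
        refine Finset.sum_le_sum fun j _ => ?_
        rw [norm_smul, Real.norm_of_nonneg (sub_nonneg.2 (hc j)), ← dist_eq_norm]
        have h1 : N * w j - c j ≤ 1 := by linarith [Nat.lt_floor_add_one (N * w j)]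
        exact (mul_le_of_le_one_left dist_nonneg h1).trans
          (Metric.dist_le_diam_of_mem hA (hz _) (hz _))
    _ = _ := by simp

/-- In a space of infratype `p` with constant `C`, given bounded nonempty sets `Aᵢ` with
diameters `dᵢ` and points `bᵢ ∈ conv Aᵢ`, one can choose `aᵢ ∈ Aᵢ` with
`‖∑ (aᵢ - bᵢ)‖ ≤ C₁ (∑ dᵢ^p)^{1/p}` where `C₁ = 2C/(2^{1-1/p} - 1)`. -/
theorem stmt6 {X : Type*} [NormedAddCommGroup X] [NormedSpace ℝ X]
    (p C : ℝ) (hp : 1 < p) (hC : 0 < C) (hX : HasInfratype X p C)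
    (n : ℕ) (A : Fin n → Set X)
    (hA : ∀ i, (A i).Nonempty ∧ Bornology.IsBounded (A i))
    (b : Fin n → X) (hb : ∀ i, b i ∈ convexHull ℝ (A i)) :
    ∃ a : Fin n → X, (∀ i, a i ∈ A i) ∧
      ‖∑ i, (a i - b i)‖ ≤
        (2 * C / ((2 : ℝ) ^ (1 - 1 / p) - 1)) * (∑ i, Metric.diam (A i) ^ p) ^ (1 / p) := by
  have hp0 : 0 < p := by linarith
  set d : Fin n → ℝ := fun i => Metric.diam (A i) with hd_def
  have hd : ∀ i, 0 ≤ d i := fun i => Metric.diam_nonneg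
  set D := (∑ i, d i ^ p) ^ (1 / p) with hD_def
  have hD : 0 ≤ D := by positivity
  have hdD : ∀ i, d i ≤ D := fun i => by
    rw [hD_def, one_div, Real.le_rpow_inv_iff_of_pos (hd i) (by positivity) hp0]
    exact Finset.single_le_sum (f := fun i => d i ^ p)
      (fun j _ => Real.rpow_nonneg (hd j) p) (Finset.mem_univ i)
  set q := (2 : ℝ) ^ (1 - 1 / p) with hq_def
  have hinv : 1 / p < 1 := by rw [div_lt_one hp0]; exact hp
  have hq1 : 1 < q := Real.one_lt_rpow one_lt_two (by linarith)
  have hq2 : q ≤ 2 := by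
    calc q ≤ (2 : ℝ) ^ (1 : ℝ) :=
          Real.rpow_le_rpow_of_exponent_le one_le_two (by linarith [one_div_pos.2 hp0])
      _ = 2 := Real.rpow_one 2
  have hr : (2 : ℝ) ^ (1 / p - 1) = q⁻¹ := by
    rw [hq_def, ← Real.rpow_neg two_pos.le, neg_sub]
  have hq0 : 0 < q - 1 := by linarith
  choose m hm using fun i => exists_average_near_of_mem_convexHull (hA i).2 (hb i)
  obtain ⟨k, hk⟩ := pow_unbounded_of_one_lt ((∑ i, (m i : ℝ)) / (C / (q - 1)))
    (one_lt_two (α := ℝ))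
  choose y hyA hy using fun i => hm i (2 ^ k) (by positivity)
  push_cast at hy
  obtain ⟨f, hf⟩ := hX.exists_selection_of_card_eq_two_pow hp hC d hd k (Fin (2 ^ k)) (by simp) y
    fun i s t => by
      rw [← dist_eq_norm]
      exact Metric.dist_le_diam_of_mem (hA i).2 (hyA i s) (hyA i t)
  refine ⟨fun i => y i (f i), fun i => hyA _ _, ?_⟩
  have hgeom : C / 2 * ∑ j ∈ Finset.range k, ((2 : ℝ) ^ (1 / p - 1)) ^ j ≤ C / (q - 1) := by
    have hlt : q⁻¹ < 1 := inv_lt_one_of_one_lt₀ hq1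
    have h1 : ∑ j ∈ Finset.range k, (q⁻¹) ^ j ≤ (1 - q⁻¹)⁻¹ := by
      rw [← tsum_geometric_of_lt_one (by positivity) hlt]
      exact (summable_geometric_of_lt_one (by positivity) hlt).sum_le_tsum _
        fun _ _ => by positivity
    have h2 : (1 - q⁻¹)⁻¹ = q / (q - 1) := by field_simp
    rw [hr]
    calc _ ≤ C / 2 * (q / (q - 1)) := by gcongr; exact h1.trans_eq h2
      _ ≤ C / 2 * (2 / (q - 1)) := by gcongr
      _ = _ := by ring
  have happrox : ‖∑ i, (((2 : ℝ) ^ k)⁻¹ • ∑ s, y i s - b i)‖ ≤ C / (q - 1) * D := by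
    calc _ ≤ ∑ i, ‖((2 : ℝ) ^ k)⁻¹ • ∑ s, y i s - b i‖ := norm_sum_le _ _
      _ ≤ ∑ i, m i * D / 2 ^ k := Finset.sum_le_sum fun i _ => (hy i).trans (by
            gcongr; exact hdD i)
      _ = (∑ i, (m i : ℝ)) / 2 ^ k * D := by
            rw [← Finset.sum_div, ← Finset.sum_mul]; ring
      _ ≤ _ := by
            refine mul_le_mul_of_nonneg_right ?_ hD
            rw [div_le_iff₀ (by positivity), mul_comm]
            exact ((div_lt_iff₀ (by positivity)).1 hk).le
  calc ‖∑ i, (y i (f i) - b i)‖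
      = ‖∑ i, (y i (f i) - ((2 : ℝ) ^ k)⁻¹ • ∑ s, y i s) +
          ∑ i, (((2 : ℝ) ^ k)⁻¹ • ∑ s, y i s - b i)‖ := by
        rw [← Finset.sum_add_distrib]; simp
    _ ≤ C / (q - 1) * D + C / (q - 1) * D := (norm_add_le _ _).trans
        (add_le_add (hf.trans (mul_le_mul_of_nonneg_right hgeom hD)) happrox)
    _ = _ := by ring
end

section
/- Let X be a real Banach space. The following assertions are equivalent: (1) there exist p > 1 and C > 0 such that X has infratype p with constant C; (2) for every multifunction F : [0,1] → (nonempty bounded subsets of X), if conv F : t ↦ conv(F(t)) is Riemann integrable, then F is Riemann integrable. -/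
open Pointwise

/-- A closed set that is stable under taking midpoints is convex. -/
theorem convex_of_isClosed_of_half_add_mem {X : Type*} [NormedAddCommGroup X] [NormedSpace ℝ X]
    {S : Set X} (hS : IsClosed S)
    (hmid : ∀ x ∈ S, ∀ y ∈ S, (1 / 2 : ℝ) • (x + y) ∈ S) : Convex ℝ S := by
  rw [convex_iff_segment_subset]
  intro x hx y hy
  rw [segment_eq_image']
  rintro _ ⟨t, ht, rfl⟩
  set T : Set ℝ := {s | x + s • (y - x) ∈ S} with hT
  have hTc : IsClosed T := hS.preimage (by fun_prop)
  have h0 : (0 : ℝ) ∈ T := by simpa [hT] using hx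
  have h1 : (1 : ℝ) ∈ T := by simpa [hT] using hy
  have hTm : ∀ s ∈ T, ∀ r ∈ T, (s + r) / 2 ∈ T := by
    intro s hs r hr
    have := hmid _ hs _ hr
    simp only [hT, Set.mem_ofPred_eq]
    convert this using 1
    module
  have key : ∀ k : ℕ, ∀ t ∈ Set.Icc (0 : ℝ) 1, ∃ s ∈ T, |s - t| ≤ (1 / 2) ^ k := by
    intro k
    induction k with
    | zero =>
      intro t ht
      refine ⟨0, h0, ?_⟩
      rw [zero_sub, abs_neg, abs_of_nonneg ht.1]
      simpa using ht.2
    | succ k ih =>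
      intro t ht
      rcases le_total t (1 / 2) with h | h
      · obtain ⟨s, hs, hst⟩ := ih (2 * t) ⟨by linarith [ht.1], by linarith⟩
        refine ⟨(0 + s) / 2, hTm _ h0 _ hs, ?_⟩
        rw [abs_le] at hst ⊢
        rw [pow_succ]
        constructor <;> linarith [hst.1, hst.2]
      · obtain ⟨s, hs, hst⟩ := ih (2 * t - 1) ⟨by linarith, by linarith [ht.2]⟩
        refine ⟨(s + 1) / 2, hTm _ hs _ h1, ?_⟩
        rw [abs_le] at hst ⊢
        rw [pow_succ]
        constructor <;> linarith [hst.1, hst.2]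
  change t ∈ T
  rw [← hTc.closure_eq, Metric.mem_closure_iff]
  intro ε hε
  obtain ⟨k, hk⟩ := exists_pow_lt_of_lt_one hε (by norm_num : (1 / 2 : ℝ) < 1)
  obtain ⟨s, hs, hst⟩ := key k t ht
  exact ⟨s, hs, by rw [dist_comm, Real.dist_eq]; linarith⟩

/-- The set of averages of `2 ^ k` points of `A`, obtained by taking midpoints `k` times. -/
def iteratedMidpoints {X : Type*} [AddCommGroup X] [Module ℝ X] (A : Set X) : ℕ → Set X
  | 0 => A
  | k + 1 => {z | ∃ x ∈ iteratedMidpoints A k, ∃ y ∈ iteratedMidpoints A k,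
      z = (1 / 2 : ℝ) • (x + y)}

theorem iteratedMidpoints_monotone {X : Type*} [AddCommGroup X] [Module ℝ X] (A : Set X) :
    Monotone (iteratedMidpoints A) :=
  monotone_nat_of_le_succ fun _ x hx => ⟨x, hx, x, hx, by module⟩

theorem convexHull_subset_closure_iUnion_iteratedMidpoints {X : Type*} [NormedAddCommGroup X]
    [NormedSpace ℝ X] (A : Set X) :
    convexHull ℝ A ⊆ closure (⋃ k, iteratedMidpoints A k) := by
  refine convexHull_min ?_ ?_
  · exact (Set.subset_iUnion (iteratedMidpoints A) 0).trans subset_closure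
  · refine convex_of_isClosed_of_half_add_mem isClosed_closure fun x hx y hy => ?_
    refine map_mem_closure₂ (f := fun x y : X => (1 / 2 : ℝ) • (x + y)) (by fun_prop) hx hy ?_
    intro a ha b hb
    simp only [Set.mem_iUnion] at ha hb ⊢
    obtain ⟨i, hi⟩ := ha
    obtain ⟨j, hj⟩ := hb
    exact ⟨max i j + 1, a, iteratedMidpoints_monotone A (le_max_left i j) hi, b,
      iteratedMidpoints_monotone A (le_max_right i j) hj, rfl⟩

theorem HasInfratype.exists_signs {X : Type*} [NormedAddCommGroup X] [NormedSpace ℝ X]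
    {p C : ℝ} (h : HasInfratype X p C) {ι : Type*} [Fintype ι] (x : ι → X) :
    ∃ α : ι → ℝ, (∀ i, α i = 1 ∨ α i = -1) ∧
      ‖∑ i, α i • x i‖ ≤ C * (∑ i, ‖x i‖ ^ p) ^ (1 / p) := by
  let e := Fintype.equivFin ι
  obtain ⟨α, hα, hn⟩ := h (Fintype.card ι) (x ∘ e.symm)
  refine ⟨α ∘ e, fun i => hα _, ?_⟩
  rw [← e.symm.sum_comp, ← e.symm.sum_comp (fun i => ‖x i‖ ^ p)]
  simpa using hn

/-- The contraction estimate behind the halving procedure. -/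
theorem two_rpow_mul_half_add_le {p C : ℝ} (hp : 1 < p) (hC : 0 < C) :
    ∃ K : ℝ, 0 ≤ K ∧ K * 2 ^ (1 / p) / 2 + C / 2 ≤ K := by
  have hq : (2 : ℝ) ^ (1 / p) < 2 := by
    calc (2 : ℝ) ^ (1 / p) < 2 ^ (1 : ℝ) :=
          Real.rpow_lt_rpow_of_exponent_lt (by norm_num) (by rw [div_lt_one] <;> linarith)
      _ = 2 := Real.rpow_one 2
  have hd : 0 < 2 - (2 : ℝ) ^ (1 / p) := by linarith
  refine ⟨C / (2 - 2 ^ (1 / p)), by positivity, le_of_eq ?_⟩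
  field_simp
  ring

theorem HasInfratype.exists_norm_sum_sub_le_of_mem_iteratedMidpoints {X : Type*}
    [NormedAddCommGroup X] [NormedSpace ℝ X] {p C K : ℝ} (h : HasInfratype X p C)
    (hp : 1 < p) (hC : 0 < C) (hK : 0 ≤ K) (hKC : K * 2 ^ (1 / p) / 2 + C / 2 ≤ K) (k : ℕ) :
    ∀ {ι : Type} [Fintype ι] (A : ι → Set X) (d : ι → ℝ),
      (∀ i, ∀ a ∈ A i, ∀ b ∈ A i, ‖a - b‖ ≤ d i) →
      ∀ x : ι → X, (∀ i, x i ∈ iteratedMidpoints (A i) k) →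
        (∀ i, 0 ≤ d i) →
        ∃ y : ι → X, (∀ i, y i ∈ A i) ∧
          ‖∑ i, x i - ∑ i, y i‖ ≤ K * (∑ i, d i ^ p) ^ (1 / p) := by
  induction k with
  | zero =>
    intro ι _ A d _ x hx hd
    refine ⟨x, hx, ?_⟩
    rw [sub_self, norm_zero]
    have : 0 ≤ ∑ i, d i ^ p := Finset.sum_nonneg fun i _ => Real.rpow_nonneg (hd i) p
    positivity
  | succ k ih =>
    intro ι _ A d hA x hx hd
    choose u hu v hv hx using hx
    have hS : 0 ≤ ∑ i, d i ^ p := Finset.sum_nonneg fun i _ => Real.rpow_nonneg (hd i) p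
    obtain ⟨y, hy, hyn⟩ := ih (ι := ι × Bool) (fun i => A i.1) (fun i => d i.1)
      (fun i => hA i.1) (fun i => if i.2 then u i.1 else v i.1)
      (by rintro ⟨i, _ | _⟩ <;> simp [hu, hv]) (fun i => hd i.1)
    obtain ⟨α, hα, hαn⟩ := h.exists_signs fun i => (1 / 2 : ℝ) • (y (i, true) - y (i, false))
    simp only [Fintype.sum_prod_type, Fintype.sum_bool, if_true, Bool.false_eq_true,
      if_false] at hyn
    have h2 : (∑ i, (d i ^ p + d i ^ p)) ^ (1 / p) = 2 ^ (1 / p) * (∑ i, d i ^ p) ^ (1 / p) := by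
      rw [← Real.mul_rpow (by norm_num) hS, Finset.mul_sum]
      simp only [two_mul]
    rw [h2] at hyn
    have h3 : (∑ i, ‖(1 / 2 : ℝ) • (y (i, true) - y (i, false))‖ ^ p) ^ (1 / p)
        ≤ 1 / 2 * (∑ i, d i ^ p) ^ (1 / p) := by
      have : (1 / 2 : ℝ) * (∑ i, d i ^ p) ^ (1 / p)
          = (∑ i, (1 / 2 * d i) ^ p) ^ (1 / p) := by
        simp_rw [fun i => Real.mul_rpow (by norm_num : (0 : ℝ) ≤ 1 / 2) (hd i) (z := p)]
        rw [← Finset.mul_sum, Real.mul_rpow (by positivity) hS, ← Real.rpow_mul (by norm_num),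
          mul_one_div_cancel (by linarith), Real.rpow_one]
      rw [this]
      refine Real.rpow_le_rpow (by positivity) (Finset.sum_le_sum fun i _ => ?_) (by positivity)
      refine Real.rpow_le_rpow (norm_nonneg _) ?_ (by linarith)
      rw [norm_smul]
      have := hA i _ (hy (i, true)) _ (hy (i, false))
      norm_num
      linarith
    refine ⟨fun i => if α i = 1 then y (i, true) else y (i, false), fun i => ?_, ?_⟩
    · dsimp only
      split_ifs
      exacts [hy (i, true), hy (i, false)]
    · have e : ∑ i, x i - ∑ i, (if α i = 1 then y (i, true) else y (i, false))
          = (1 / 2 : ℝ) • (∑ i, (u i + v i) - ∑ i, (y (i, true) + y (i, false)))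
            - ∑ i, α i • (1 / 2 : ℝ) • (y (i, true) - y (i, false)) := by
        rw [← Finset.sum_sub_distrib, ← Finset.sum_sub_distrib, Finset.smul_sum,
          ← Finset.sum_sub_distrib]
        refine Finset.sum_congr rfl fun i _ => ?_
        rw [hx]
        rcases hα i with h | h
        · rw [if_pos h, h]; module
        · rw [if_neg (by rw [h]; norm_num), h]; module
      rw [e]
      refine (norm_sub_le _ _).trans ?_
      rw [norm_smul]
      set D := (∑ i, d i ^ p) ^ (1 / p) with hD
      have hD0 : 0 ≤ D := by positivity
      have h4 : C * (∑ i, ‖(1 / 2 : ℝ) • (y (i, true) - y (i, false))‖ ^ p) ^ (1 / p)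
          ≤ C * (1 / 2 * D) := by gcongr
      have h5 := mul_le_mul_of_nonneg_right hKC hD0
      norm_num at hyn ⊢
      norm_num at hαn h4 h5
      linarith

/-- In a space of nontrivial infratype, points of convex hulls can be replaced by points of the
original sets with a controlled change of their sum. -/
theorem HasInfratype.exists_norm_sum_sub_le {X : Type*} [NormedAddCommGroup X] [NormedSpace ℝ X]
    {p C : ℝ} (h : HasInfratype X p C) (hp : 1 < p) (hC : 0 < C) :
    ∃ K : ℝ, 0 ≤ K ∧ ∀ {ι : Type} [Fintype ι] (A : ι → Set X) (d : ι → ℝ),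
      (∀ i, ∀ a ∈ A i, ∀ b ∈ A i, ‖a - b‖ ≤ d i) → (∀ i, 0 ≤ d i) →
      ∀ x : ι → X, (∀ i, x i ∈ convexHull ℝ (A i)) → ∀ ε > 0,
        ∃ y : ι → X, (∀ i, y i ∈ A i) ∧
          ‖∑ i, x i - ∑ i, y i‖ ≤ K * (∑ i, d i ^ p) ^ (1 / p) + ε := by
  obtain ⟨K, hK, hKC⟩ := two_rpow_mul_half_add_le hp hC
  refine ⟨K, hK, fun {ι} _ A d hA hd x hx ε hε => ?_⟩
  have hη : 0 < ε / (Fintype.card ι + 1) := by positivity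
  have happrox : ∀ i, ∃ k, ∃ z ∈ iteratedMidpoints (A i) k,
      dist (x i) z < ε / (Fintype.card ι + 1) := fun i => by
    obtain ⟨z, hz, hxz⟩ := Metric.mem_closure_iff.1
      (convexHull_subset_closure_iUnion_iteratedMidpoints _ (hx i)) _ hη
    obtain ⟨k, hk⟩ := Set.mem_iUnion.1 hz
    exact ⟨k, z, hk, hxz⟩
  choose k z hz hxz using happrox
  obtain ⟨y, hy, hyn⟩ := h.exists_norm_sum_sub_le_of_mem_iteratedMidpoints hp hC hK hKC
    (Finset.univ.sup k) A d hA z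
    (fun i => iteratedMidpoints_monotone _ (Finset.le_sup (Finset.mem_univ i)) (hz i)) hd
  refine ⟨y, hy, ?_⟩
  have h1 : ‖∑ i, x i - ∑ i, z i‖ ≤ ε := by
    rw [← Finset.sum_sub_distrib]
    calc ‖∑ i, (x i - z i)‖ ≤ ∑ _i : ι, ε / (Fintype.card ι + 1) :=
          norm_sum_le_of_le _ fun i _ => by rw [← dist_eq_norm]; exact (hxz i).le
      _ = Fintype.card ι * (ε / (Fintype.card ι + 1)) := by simp
      _ ≤ ε := by
          rw [mul_div_assoc', div_le_iff₀ (by positivity)]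
          nlinarith
  calc ‖∑ i, x i - ∑ i, y i‖ ≤ ‖∑ i, x i - ∑ i, z i‖ + ‖∑ i, z i - ∑ i, y i‖ :=
        norm_sub_le_norm_sub_add_norm_sub _ _ _
    _ ≤ _ := by linarith

/-- The partition of `[0,1]` into `N` intervals of equal length, with prescribed tags. -/
noncomputable def uniformPartition (N : ℕ) (hN : 0 < N) (t : Fin N → ℝ)
    (ht : ∀ i : Fin N, t i ∈ Set.Icc ((i : ℝ) / N) (((i : ℝ) + 1) / N)) : TaggedPartition where
  n := N
  npos := hN
  x i := (i : ℝ) / N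
  t := t
  mono i j hij := by
    have : (i : ℝ) ≤ j := by exact_mod_cast hij
    dsimp only
    gcongr
  x_zero := by simp
  x_last := by
    have : (N : ℝ) ≠ 0 := by positivity
    simp [this]
  tag_mem i := by simpa using ht i

theorem mesh_uniformPartition (N : ℕ) (hN : 0 < N) (t : Fin N → ℝ)
    (ht : ∀ i : Fin N, t i ∈ Set.Icc ((i : ℝ) / N) (((i : ℝ) + 1) / N)) :
    (uniformPartition N hN t ht).mesh = 1 / N := by
  have : Nonempty (Fin N) := ⟨⟨0, hN⟩⟩
  have h : ∀ i : Fin N, (((i.succ : Fin (N + 1)) : ℝ) / N - ((i.castSucc : Fin (N + 1)) : ℝ) / N)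
      = 1 / N := fun i => by
    rw [Fin.val_succ, Fin.val_castSucc]; push_cast; ring
  change ⨆ i : Fin N, (((i.succ : Fin (N + 1)) : ℝ) / N - ((i.castSucc : Fin (N + 1)) : ℝ) / N) = _
  simp_rw [h]
  exact ciSup_const

theorem setRiemannSum_uniformPartition {X : Type*} [NormedAddCommGroup X] [NormedSpace ℝ X]
    (F : ℝ → Set X) (N : ℕ) (hN : 0 < N) (t : Fin N → ℝ)
    (ht : ∀ i : Fin N, t i ∈ Set.Icc ((i : ℝ) / N) (((i : ℝ) + 1) / N)) :
    setRiemannSum F (uniformPartition N hN t ht) = ∑ i, (1 / N : ℝ) • F (t i) := by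
  change ∑ i : Fin N, (((i.succ : Fin (N + 1)) : ℝ) / N - ((i.castSucc : Fin (N + 1)) : ℝ) / N)
    • F (t i) = _
  refine Finset.sum_congr rfl fun i _ => ?_
  congr 1
  rw [Fin.val_succ, Fin.val_castSucc]; push_cast; ring

theorem TaggedPartition.length_nonneg (T : TaggedPartition) (i : Fin T.n) :
    0 ≤ T.x i.succ - T.x i.castSucc :=
  sub_nonneg.2 (T.mono i.castSucc_le_succ)

theorem TaggedPartition.length_le_mesh (T : TaggedPartition) (i : Fin T.n) :
    T.x i.succ - T.x i.castSucc ≤ T.mesh :=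
  le_ciSup (f := fun i : Fin T.n => T.x i.succ - T.x i.castSucc)
    (Set.finite_range _).bddAbove i

theorem TaggedPartition.mesh_nonneg (T : TaggedPartition) : 0 ≤ T.mesh :=
  (T.length_nonneg ⟨0, T.npos⟩).trans (T.length_le_mesh _)

theorem TaggedPartition.sum_length (T : TaggedPartition) :
    ∑ i : Fin T.n, (T.x i.succ - T.x i.castSucc) = 1 := by
  have h := Fin.sum_univ_succ T.x
  rw [Fin.sum_univ_castSucc, T.x_zero, T.x_last] at h
  rw [Finset.sum_sub_distrib]
  linarith

theorem mem_setRiemannSum {X : Type*} [NormedAddCommGroup X] [NormedSpace ℝ X]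
    {F : ℝ → Set X} {T : TaggedPartition} {z : X} :
    z ∈ setRiemannSum F T ↔ ∃ a : Fin T.n → X, (∀ i, a i ∈ F (T.t i)) ∧
      ∑ i, (T.x i.succ - T.x i.castSucc) • a i = z := by
  rw [setRiemannSum, Set.mem_fintype_sum]
  constructor
  · rintro ⟨g, hg, rfl⟩
    choose a ha hga using hg
    exact ⟨a, ha, Finset.sum_congr rfl fun i _ => hga i⟩
  · rintro ⟨a, ha, rfl⟩
    exact ⟨_, fun i => Set.smul_mem_smul_set (ha i), rfl⟩

theorem IsMultifunction.setRiemannSum_nonempty {X : Type*} [NormedAddCommGroup X] [NormedSpace ℝ X]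
    {F : ℝ → Set X} (hF : IsMultifunction F) (T : TaggedPartition) :
    (setRiemannSum F T).Nonempty := by
  choose a ha using fun i => (hF _ (T.tag_mem_Icc i)).1
  exact ⟨_, mem_setRiemannSum.2 ⟨a, ha, rfl⟩⟩

theorem IsMultifunction.isBounded_setRiemannSum {X : Type*} [NormedAddCommGroup X]
    [NormedSpace ℝ X] {F : ℝ → Set X} (hF : IsMultifunction F) (T : TaggedPartition) :
    Bornology.IsBounded (setRiemannSum F T) := by
  choose R hR using fun i => (hF _ (T.tag_mem_Icc i)).2.exists_norm_le
  refine isBounded_iff_forall_norm_le.2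
    ⟨∑ i, (T.x i.succ - T.x i.castSucc) * R i, fun z hz => ?_⟩
  obtain ⟨a, ha, rfl⟩ := mem_setRiemannSum.1 hz
  refine norm_sum_le_of_le _ fun i _ => ?_
  rw [norm_smul, Real.norm_of_nonneg (T.length_nonneg i)]
  exact mul_le_mul_of_nonneg_left (hR i _ (ha i)) (T.length_nonneg i)

theorem IsMultifunction.convexHull {X : Type*} [NormedAddCommGroup X] [NormedSpace ℝ X]
    {F : ℝ → Set X} (hF : IsMultifunction F) :
    IsMultifunction fun t => convexHull ℝ (F t) :=
  fun t ht => ⟨(hF t ht).1.convexHull, isBounded_convexHull.2 (hF t ht).2⟩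

/-- A multifunction which is Riemann integrable is bounded. -/
theorem IsSetRiemannIntegral.exists_norm_le {X : Type*} [NormedAddCommGroup X] [NormedSpace ℝ X]
    {F : ℝ → Set X} (hF : IsMultifunction F) {A : Set X} (hA : IsSetRiemannIntegral F A) :
    ∃ M : ℝ, 0 ≤ M ∧ ∀ t ∈ Set.Icc (0 : ℝ) 1, ∀ a ∈ F t, ‖a‖ ≤ M := by
  obtain ⟨hAne, -, hAb, hlim⟩ := hA
  obtain ⟨R, hR⟩ := hAb.exists_norm_le
  obtain ⟨δ, hδ, hδT⟩ := hlim 1 one_pos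
  obtain ⟨n, hn⟩ := exists_nat_one_div_lt hδ
  set N := n + 1 with hNdef
  have hN : 0 < N := n.succ_pos
  have hN' : (0 : ℝ) < N := by exact_mod_cast hN
  have htag : ∀ i : Fin N, (i : ℝ) / N ∈ Set.Icc ((i : ℝ) / N) (((i : ℝ) + 1) / N) := fun i =>
    ⟨le_rfl, by gcongr; linarith⟩
  have htag01 : ∀ i : Fin N, (i : ℝ) / N ∈ Set.Icc (0 : ℝ) 1 := fun i =>
    (uniformPartition N hN _ htag).tag_mem_Icc i
  choose b hb using fun i : Fin N => (hF _ (htag01 i)).1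
  have hR0 : 0 ≤ R := (norm_nonneg _).trans (hR _ hAne.some_mem)
  refine ⟨N * (R + 1) + ∑ i, ‖b i‖, by positivity, fun t ht a ha => ?_⟩
  obtain ⟨i, hi⟩ : ∃ i : Fin N, t ∈ Set.Icc ((i : ℝ) / N) (((i : ℝ) + 1) / N) := by
    rcases eq_or_lt_of_le ht.2 with h | h
    · refine ⟨⟨n, n.lt_succ_self⟩, ?_⟩
      have hNn : (N : ℝ) = n + 1 := by rw [hNdef]; push_cast; rfl
      rw [h, Set.mem_Icc, div_le_one hN', one_le_div hN']
      dsimp only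
      constructor <;> linarith
    · refine ⟨⟨⌊t * N⌋₊, ?_⟩, ?_⟩
      · rw [Nat.floor_lt (by have := ht.1; positivity)]
        nlinarith
      · rw [Set.mem_Icc, div_le_iff₀ hN', le_div_iff₀ hN']
        exact ⟨Nat.floor_le (by have := ht.1; positivity), (Nat.lt_floor_add_one _).le⟩
  set τ : Fin N → ℝ := Function.update (fun i => (i : ℝ) / N) i t with hτ
  have hτm : ∀ j : Fin N, τ j ∈ Set.Icc ((j : ℝ) / N) (((j : ℝ) + 1) / N) := fun j => by
    rcases eq_or_ne j i with rfl | hj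
    · simpa [hτ] using hi
    · simpa [hτ, hj] using htag j
  set T := uniformPartition N hN τ hτm with hT
  set c : Fin N → X := Function.update b i a with hc
  have hcm : ∀ j, c j ∈ F (τ j) := fun j => by
    rcases eq_or_ne j i with rfl | hj
    · simpa [hτ, hc] using ha
    · simpa [hτ, hc, hj] using hb j
  have hmem : ∑ j, (1 / N : ℝ) • c j ∈ setRiemannSum F T := by
    rw [hT, setRiemannSum_uniformPartition, Set.mem_fintype_sum]
    exact ⟨_, fun j => Set.smul_mem_smul_set (hcm j), rfl⟩
  have hmesh : T.mesh < δ := by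
    rw [hT, mesh_uniformPartition, hNdef]
    push_cast
    exact hn
  obtain ⟨y, hy, hdist⟩ := Metric.exists_dist_lt_of_hausdorffDist_lt hmem (hδT T hmesh)
    (Metric.hausdorffEDist_ne_top_of_nonempty_of_bounded (hF.setRiemannSum_nonempty T) hAne
      (hF.isBounded_setRiemannSum T) hAb)
  have h1 : ‖∑ j, (1 / N : ℝ) • c j‖ ≤ R + 1 := by
    rw [dist_eq_norm] at hdist
    have := norm_le_norm_add_norm_sub' (∑ j, (1 / N : ℝ) • c j) y
    linarith [hR y hy]
  rw [← Finset.smul_sum, norm_smul, Real.norm_of_nonneg (by positivity), one_div,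
    inv_mul_le_iff₀ hN', ← Finset.add_sum_erase _ _ (Finset.mem_univ i)] at h1
  have h2 : ‖∑ j ∈ Finset.univ.erase i, c j‖ ≤ ∑ j, ‖b j‖ := by
    refine (norm_sum_le_of_le (f := c) (n := fun j => ‖b j‖) _ fun j hj => ?_).trans
      (Finset.sum_le_sum_of_subset_of_nonneg (Finset.erase_subset _ _) fun _ _ _ => norm_nonneg _)
    simp [hc, Finset.ne_of_mem_erase hj]
  have h3 : c i = a := by simp [hc]
  rw [h3] at h1
  have := norm_sub_le (a + ∑ j ∈ Finset.univ.erase i, c j) (∑ j ∈ Finset.univ.erase i, c j)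
  rw [add_sub_cancel_right] at this
  linarith

/-- In a space of nontrivial infratype, the Riemann sums of a bounded multifunction and of its
convex hull are close when the mesh is small. -/
theorem HasInfratype.exists_hausdorffDist_setRiemannSum_lt {X : Type*} [NormedAddCommGroup X]
    [NormedSpace ℝ X] {p C : ℝ} (h : HasInfratype X p C) (hp : 1 < p) (hC : 0 < C)
    {F : ℝ → Set X} {M : ℝ} (hM : 0 ≤ M)
    (hF : ∀ t ∈ Set.Icc (0 : ℝ) 1, ∀ a ∈ F t, ‖a‖ ≤ M) {ε : ℝ} (hε : 0 < ε) :
    ∃ δ > 0, ∀ T : TaggedPartition, T.mesh < δ →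
      Metric.hausdorffDist (setRiemannSum F T) (setRiemannSum (fun t => convexHull ℝ (F t)) T)
        < ε := by
  obtain ⟨K, hK, hKT⟩ := h.exists_norm_sum_sub_le hp hC
  have hlim : Filter.Tendsto (fun s : ℝ => K * (2 * M * s ^ ((p - 1) / p)) + ε / 2)
      (nhds 0) (nhds (K * (2 * M * (0 : ℝ) ^ ((p - 1) / p)) + ε / 2)) := by
    have : Filter.Tendsto (fun s : ℝ => s ^ ((p - 1) / p)) (nhds 0)
        (nhds ((0 : ℝ) ^ ((p - 1) / p))) :=
      (Real.continuousAt_rpow_const _ _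
        (Or.inr (div_nonneg (by linarith) (by linarith)))).tendsto
    exact ((this.const_mul _).const_mul _).add_const _
  rw [Real.zero_rpow (div_pos (by linarith) (by linarith)).ne', mul_zero, mul_zero,
    zero_add] at hlim
  obtain ⟨δ, hδ, hball⟩ := Metric.eventually_nhds_iff.1 (hlim.eventually_lt_const (half_lt_self hε))
  refine ⟨δ, hδ, fun T hT => ?_⟩
  have hm := T.mesh_nonneg
  refine lt_of_le_of_lt ?_ (hball (y := T.mesh)
    (by rwa [Real.dist_eq, sub_zero, abs_of_nonneg hm]))
  refine Metric.hausdorffDist_le_of_mem_dist (by positivity) ?_ ?_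
  · intro z hz
    obtain ⟨a, ha, rfl⟩ := mem_setRiemannSum.1 hz
    refine ⟨_, mem_setRiemannSum.2 ⟨a, fun i => subset_convexHull ℝ _ (ha i), rfl⟩, ?_⟩
    rw [dist_self]
    positivity
  · intro z hz
    obtain ⟨a, ha, rfl⟩ := mem_setRiemannSum.1 hz
    have hl := T.length_nonneg
    obtain ⟨y, hy, hyn⟩ := hKT
      (fun i : Fin T.n => (T.x i.succ - T.x i.castSucc) • F (T.t i))
      (fun i => (T.x i.succ - T.x i.castSucc) * (2 * M))
      (by
        rintro i _ ⟨u, hu, rfl⟩ _ ⟨v, hv, rfl⟩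
        dsimp only
        rw [← smul_sub, norm_smul, Real.norm_of_nonneg (hl i)]
        refine mul_le_mul_of_nonneg_left ?_ (hl i)
        linarith [norm_sub_le u v, hF _ (T.tag_mem_Icc i) u hu, hF _ (T.tag_mem_Icc i) v hv])
      (fun i => mul_nonneg (hl i) (by positivity))
      (fun i => (T.x i.succ - T.x i.castSucc) • a i)
      (fun i => by
        rw [convexHull_smul]
        exact Set.smul_mem_smul_set (ha i)) (ε / 2) (half_pos hε)
    refine ⟨∑ i, y i, ?_, ?_⟩
    · rw [setRiemannSum, Set.mem_fintype_sum]
      exact ⟨y, hy, rfl⟩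
    · rw [dist_eq_norm]
      refine hyn.trans ?_
      gcongr
      have hp0 : p ≠ 0 := by linarith
      have hsum : ∑ i : Fin T.n, ((T.x i.succ - T.x i.castSucc) * (2 * M)) ^ p
          ≤ T.mesh ^ (p - 1) * (2 * M) ^ p := by
        calc ∑ i : Fin T.n, ((T.x i.succ - T.x i.castSucc) * (2 * M)) ^ p
            ≤ ∑ i : Fin T.n,
                (T.x i.succ - T.x i.castSucc) * (T.mesh ^ (p - 1) * (2 * M) ^ p) := by
              refine Finset.sum_le_sum fun i _ => ?_
              rw [Real.mul_rpow (hl i) (by positivity), ← mul_assoc]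
              refine mul_le_mul_of_nonneg_right ?_ (by positivity)
              rcases (hl i).eq_or_lt with h0 | h0
              · rw [← h0, Real.zero_rpow hp0, zero_mul]
              · have e : (T.x i.succ - T.x i.castSucc) ^ p
                    = (T.x i.succ - T.x i.castSucc) * (T.x i.succ - T.x i.castSucc) ^ (p - 1) := by
                  rw [← Real.rpow_one_add' h0.le (by linarith)]
                  congr 1
                  ring
                rw [e]
                refine mul_le_mul_of_nonneg_left ?_ h0.le
                exact Real.rpow_le_rpow h0.le (T.length_le_mesh i) (by linarith)
          _ = _ := by rw [← Finset.sum_mul, T.sum_length, one_mul]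
      calc (∑ i : Fin T.n, ((T.x i.succ - T.x i.castSucc) * (2 * M)) ^ p) ^ (1 / p)
          ≤ (T.mesh ^ (p - 1) * (2 * M) ^ p) ^ (1 / p) := by
            refine Real.rpow_le_rpow (Finset.sum_nonneg fun i _ => ?_) hsum (by positivity)
            exact Real.rpow_nonneg (mul_nonneg (hl i) (by positivity)) _
        _ = 2 * M * T.mesh ^ ((p - 1) / p) := by
            rw [Real.mul_rpow (by positivity) (by positivity), ← Real.rpow_mul hm,
              ← Real.rpow_mul (by positivity), mul_one_div_cancel hp0, Real.rpow_one,
              mul_one_div, mul_comm]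

theorem HasInfratype.setRiemannIntegrable {X : Type*} [NormedAddCommGroup X] [NormedSpace ℝ X]
    {p C : ℝ} (h : HasInfratype X p C) (hp : 1 < p) (hC : 0 < C) {F : ℝ → Set X}
    (hF : IsMultifunction F) (hconv : SetRiemannIntegrable fun t => convexHull ℝ (F t)) :
    SetRiemannIntegrable F := by
  obtain ⟨A, hA⟩ := hconv
  obtain ⟨M, hM, hFM⟩ := hA.exists_norm_le hF.convexHull
  refine ⟨A, hA.1, hA.2.1, hA.2.2.1, fun ε hε => ?_⟩
  obtain ⟨δ₁, hδ₁, h₁⟩ := hA.2.2.2 (ε / 2) (half_pos hε)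
  obtain ⟨δ₂, hδ₂, h₂⟩ := h.exists_hausdorffDist_setRiemannSum_lt hp hC hM
    (fun t ht a ha => hFM t ht a (subset_convexHull ℝ _ ha)) (half_pos hε)
  refine ⟨min δ₁ δ₂, lt_min hδ₁ hδ₂, fun T hT => ?_⟩
  have := Metric.hausdorffDist_triangle (u := A)
    (Metric.hausdorffEDist_ne_top_of_nonempty_of_bounded (hF.setRiemannSum_nonempty T)
      (hF.convexHull.setRiemannSum_nonempty T) (hF.isBounded_setRiemannSum T)
      (hF.convexHull.isBounded_setRiemannSum T))
  linarith [h₁ T (hT.trans_le (min_le_left _ _)), h₂ T (hT.trans_le (min_le_right _ _))]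

/-- Replacing the members of a block by a single signed sum at one index of the block. -/
theorem exists_signs_of_merge {X ι : Type*} [NormedAddCommGroup X] [NormedSpace ℝ X] [Fintype ι]
    [DecidableEq ι] (x : ι → X) (s : Finset ι) (i₀ : ι) (hi₀ : i₀ ∈ s) (γ β : ι → ℝ)
    (hγ : ∀ i, γ i = 1 ∨ γ i = -1) (hβ : ∀ i, β i = 1 ∨ β i = -1) :
    ∃ α : ι → ℝ, (∀ i, α i = 1 ∨ α i = -1) ∧
      ∑ i, α i • x i = ∑ i, β i •
        (if i = i₀ then ∑ j ∈ s, γ j • x j else if i ∈ s then 0 else x i) := by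
  refine ⟨fun i => if i ∈ s then β i₀ * γ i else β i, fun i => ?_, ?_⟩
  · dsimp only
    split_ifs
    · rcases hγ i with h | h <;> rcases hβ i₀ with h' | h' <;> simp [h, h']
    · exact hβ i
  · rw [← Finset.sum_add_sum_compl s, ← Finset.sum_add_sum_compl s]
    congr 1
    · symm
      rw [Finset.sum_eq_single_of_mem i₀ hi₀ fun i hi hne => by simp [hi, hne], if_pos rfl,
        Finset.smul_sum]
      exact Finset.sum_congr rfl fun i hi => by
        beta_reduce; rw [if_pos hi, mul_smul]
    · refine Finset.sum_congr rfl fun i hi => ?_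
      have hi' : i ∉ s := Finset.mem_compl.1 hi
      beta_reduce
      rw [if_neg hi', if_neg (fun h : i = i₀ => hi' (h ▸ hi₀)), if_neg hi']

theorem exists_one_lt_rpow_le {a b : ℝ} (ha : 0 < a) (hab : a < b) :
    ∃ p : ℝ, 1 < p ∧ a ^ p ≤ b := by
  have hlim : Filter.Tendsto (fun p : ℝ => a ^ p) (nhdsWithin 1 (Set.Ioi 1)) (nhds (a ^ (1 : ℝ))) :=
    ((Real.continuous_const_rpow ha.ne').tendsto 1).mono_left nhdsWithin_le_nhds
  rw [Real.rpow_one] at hlim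
  obtain ⟨p, hp, hp1⟩ := ((hlim.eventually_lt_const hab).and self_mem_nhdsWithin).exists
  exact ⟨p, hp1, hp.le⟩

/-- A sum in which each geometric bucket is hit fewer than `m` times is dominated by a geometric
series. -/
theorem sum_pow_le_of_card_fiber_le {ι : Type*} (W : Finset ι) (κ : ι → ℕ) (m : ℕ) {μ : ℝ}
    (hμ : 0 ≤ μ) (hμ1 : μ < 1) (hκ : ∀ j, (W.filter fun i => κ i = j).card ≤ m) :
    ∑ i ∈ W, μ ^ κ i ≤ m * (1 - μ)⁻¹ := by
  classical
  rw [← Finset.sum_fiberwise_of_maps_to (t := W.image κ) (g := κ)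
    fun i hi => Finset.mem_image_of_mem κ hi]
  calc ∑ j ∈ W.image κ, ∑ i ∈ W with κ i = j, μ ^ κ i
      ≤ ∑ j ∈ W.image κ, m * μ ^ j := by
        refine Finset.sum_le_sum fun j _ => ?_
        rw [Finset.sum_congr rfl (g := fun _ => μ ^ j)
          fun i hi => by rw [(Finset.mem_filter.1 hi).2], Finset.sum_const, nsmul_eq_mul]
        have : ((W.filter fun i => κ i = j).card : ℝ) ≤ m := by exact_mod_cast hκ j
        gcongr
    _ = m * ∑ j ∈ W.image κ, μ ^ j := by rw [Finset.mul_sum]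
    _ ≤ m * (1 - μ)⁻¹ := by
        rw [← tsum_geometric_of_lt_one hμ hμ1]
        gcongr
        exact (summable_geometric_of_lt_one hμ hμ1).sum_le_tsum _ fun _ _ => by positivity

/-- If signed sums of `m` vectors of the unit ball can always be made slightly shorter than `m`,
then the space has nontrivial infratype. -/
theorem exists_hasInfratype_of_forall_exists_signs {X : Type*} [NormedAddCommGroup X]
    [NormedSpace ℝ X] {m : ℕ} (hm : 2 ≤ m)
    (h : ∀ y : Fin m → X, (∀ j, ‖y j‖ ≤ 1) → ∃ α : Fin m → ℝ, (∀ j, α j = 1 ∨ α j = -1) ∧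
      ‖∑ j, α j • y j‖ ≤ m - 1 / 2) :
    ∃ p > (1 : ℝ), ∃ C > (0 : ℝ), HasInfratype X p C := by
  classical
  have hmR : (2 : ℝ) ≤ m := by exact_mod_cast hm
  obtain ⟨p, hp, hpm⟩ := exists_one_lt_rpow_le (a := (m : ℝ) - 1 / 4) (b := m)
    (by linarith) (by linarith)
  set μ : ℝ := (m - 1 / 2) / (m - 1 / 4) with hμdef
  have hμ : 0 < μ := div_pos (by linarith) (by linarith)
  have hμ1 : μ < 1 := (div_lt_one (by linarith)).2 (by linarith)
  have hμp : ((m : ℝ) - 1 / 2) ^ p ≤ m * μ ^ p := by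
    calc ((m : ℝ) - 1 / 2) ^ p = ((m - 1 / 4) * μ) ^ p := by
          rw [hμdef, mul_div_cancel₀ _ (by linarith : (m : ℝ) - 1 / 4 ≠ 0)]
      _ = (m - 1 / 4) ^ p * μ ^ p := Real.mul_rpow (by linarith) hμ.le
      _ ≤ m * μ ^ p := by gcongr
  have h1μ : 0 < 1 - μ := by linarith
  refine ⟨p, hp, m * (1 - μ)⁻¹, by positivity, fun n => ?_⟩
  have hscaled : ∀ (x : Fin n → X) (s : Finset (Fin n)) (r : ℝ), s.card = m → 0 < r →
      (∀ i ∈ s, ‖x i‖ ≤ r) → ∃ γ : Fin n → ℝ, (∀ i, γ i = 1 ∨ γ i = -1) ∧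
        ‖∑ i ∈ s, γ i • x i‖ ≤ (m - 1 / 2) * r := by
    intro x s r hs hr hx
    let e := s.equivFinOfCardEq hs
    obtain ⟨α, hα, hαn⟩ := h (fun j => r⁻¹ • x (e.symm j)) fun j => by
      rw [norm_smul, norm_inv, Real.norm_of_nonneg hr.le, inv_mul_le_iff₀ hr, mul_one]
      exact hx _ (e.symm j).2
    refine ⟨fun i => if hi : i ∈ s then α (e ⟨i, hi⟩) else 1, fun i => ?_, ?_⟩
    · dsimp only
      split_ifs
      exacts [hα _, Or.inl rfl]
    · have e1 : ∑ i ∈ s, (if hi : i ∈ s then α (e ⟨i, hi⟩) else 1) • x i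
          = r • ∑ j, α j • r⁻¹ • x (e.symm j) := by
        rw [← Finset.sum_coe_sort s, Finset.smul_sum, ← e.sum_comp]
        refine Finset.sum_congr rfl fun i _ => ?_
        rw [dif_pos i.2, Equiv.symm_apply_apply, smul_comm, smul_smul r, mul_inv_cancel₀ hr.ne',
          one_smul]
      rw [e1, norm_smul, Real.norm_of_nonneg hr.le, mul_comm]
      gcongr
  suffices H : ∀ (k : ℕ) (x : Fin n → X), (Finset.univ.filter fun i => x i ≠ 0).card = k →
      ∃ α : Fin n → ℝ, (∀ i, α i = 1 ∨ α i = -1) ∧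
        ‖∑ i, α i • x i‖ ≤ m * (1 - μ)⁻¹ * (∑ i, ‖x i‖ ^ p) ^ (1 / p) from
    fun x => H _ x rfl
  intro k
  induction k using Nat.strong_induction_on with
  | _ k ih =>
  intro x hxk
  have hp0 : 0 < p := by linarith
  set W := Finset.univ.filter fun i => x i ≠ 0 with hW
  set R := (∑ i, ‖x i‖ ^ p) ^ (1 / p) with hR
  have hR0 : 0 ≤ R := by positivity
  have hxR : ∀ i, ‖x i‖ ≤ R := fun i => by
    calc ‖x i‖ = (‖x i‖ ^ p) ^ (1 / p) := by
          rw [← Real.rpow_mul (norm_nonneg _), mul_one_div_cancel hp0.ne', Real.rpow_one]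
      _ ≤ R := by
          refine Real.rpow_le_rpow (by positivity) ?_ (by positivity)
          exact Finset.single_le_sum (f := fun i => ‖x i‖ ^ p) (fun i _ => by positivity)
            (Finset.mem_univ i)
  have hbucket : ∀ i, ∃ j : ℕ, i ∈ W → R * μ ^ (j + 1) ≤ ‖x i‖ ∧ ‖x i‖ ≤ R * μ ^ j := by
    intro i
    by_cases hi : i ∈ W
    · have hpos : 0 < ‖x i‖ := norm_pos_iff.2 (Finset.mem_filter.1 hi).2
      have hRpos : 0 < R := hpos.trans_le (hxR i)
      obtain ⟨j, hj1, hj2⟩ := exists_nat_pow_near_of_lt_one (div_pos hpos hRpos)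
        ((div_le_one hRpos).2 (hxR i)) hμ hμ1
      rw [lt_div_iff₀ hRpos] at hj1
      rw [div_le_iff₀ hRpos] at hj2
      exact ⟨j, fun _ => ⟨by linarith, by linarith⟩⟩
    · exact ⟨0, fun h => absurd h hi⟩
  choose κ hκ using hbucket
  by_cases hfib : ∀ j, (W.filter fun i => κ i = j).card ≤ m
  · refine ⟨fun _ => 1, fun _ => Or.inl rfl, ?_⟩
    simp only [one_smul]
    calc ‖∑ i, x i‖ ≤ ∑ i, ‖x i‖ := norm_sum_le _ _
      _ = ∑ i ∈ W, ‖x i‖ := by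
          refine (Finset.sum_subset (Finset.subset_univ W) fun i _ hi => ?_).symm
          simpa [hW] using hi
      _ ≤ ∑ i ∈ W, R * μ ^ κ i := Finset.sum_le_sum fun i hi => (hκ i hi).2
      _ = R * ∑ i ∈ W, μ ^ κ i := by rw [Finset.mul_sum]
      _ ≤ R * (m * (1 - μ)⁻¹) := by
          gcongr
          exact sum_pow_le_of_card_fiber_le W κ m hμ.le hμ1 hfib
      _ = _ := mul_comm _ _
  · push Not at hfib
    obtain ⟨j, hj⟩ := hfib
    obtain ⟨s, hsW, hsc⟩ := Finset.exists_subset_card_eq hj.le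
    have hs : ∀ i ∈ s, i ∈ W ∧ κ i = j := fun i hi => Finset.mem_filter.1 (hsW hi)
    obtain ⟨i₀, hi₀, i₁, hi₁, hne⟩ := Finset.one_lt_card.1 (by omega : 1 < s.card)
    have hRpos : 0 < R :=
      (norm_pos_iff.2 (Finset.mem_filter.1 (hs i₀ hi₀).1).2).trans_le (hxR i₀)
    have hr : 0 < R * μ ^ j := by positivity
    obtain ⟨γ, hγ, hγn⟩ := hscaled x s (R * μ ^ j) hsc hr fun i hi => by
      have := (hκ i (hs i hi).1).2
      rwa [(hs i hi).2] at this
    set x' : Fin n → X := fun i =>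
      if i = i₀ then ∑ j ∈ s, γ j • x j else if i ∈ s then 0 else x i with hx'
    have hx's : ∀ i ∈ s, i ≠ i₀ → x' i = 0 := fun i hi hne => by simp [hx', hi, hne]
    have hx'c : ∀ i ∈ sᶜ, x' i = x i := fun i hi => by
      have hi' : i ∉ s := Finset.mem_compl.1 hi
      simp only [hx', if_neg hi', if_neg (fun h => hi' (h ▸ hi₀) : i ≠ i₀)]
    have hcard : (Finset.univ.filter fun i => x' i ≠ 0).card < k := by
      rw [← hxk]
      refine Finset.card_lt_card (Finset.ssubset_iff_of_subset ?_ |>.2 ?_)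
      · intro i hi
        have hi0 := (Finset.mem_filter.1 hi).2
        by_cases his : i ∈ s
        · exact (hs i his).1
        · rw [hx'c i (Finset.mem_compl.2 his)] at hi0
          exact Finset.mem_filter.2 ⟨Finset.mem_univ _, hi0⟩
      · refine ⟨i₁, (hs i₁ hi₁).1, ?_⟩
        simp [hx's i₁ hi₁ hne.symm]
    obtain ⟨β, hβ, hβn⟩ := ih _ hcard x' rfl
    obtain ⟨α, hα, hαe⟩ := exists_signs_of_merge x s i₀ hi₀ γ β hγ hβ
    refine ⟨α, hα, ?_⟩
    rw [hαe]
    refine hβn.trans ?_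
    have hsum : ∑ i, ‖x' i‖ ^ p ≤ ∑ i, ‖x i‖ ^ p := by
      rw [← Finset.sum_add_sum_compl s, ← Finset.sum_add_sum_compl s fun i => ‖x i‖ ^ p]
      refine add_le_add ?_ (Finset.sum_congr rfl fun i hi => by rw [hx'c i hi]).le
      rw [Finset.sum_eq_single_of_mem i₀ hi₀ fun i hi hne => by
        rw [hx's i hi hne, norm_zero, Real.zero_rpow hp0.ne']]
      have hx'0 : x' i₀ = ∑ j ∈ s, γ j • x j := by simp [hx']
      rw [hx'0]
      calc ‖∑ j ∈ s, γ j • x j‖ ^ p ≤ ((m - 1 / 2) * (R * μ ^ j)) ^ p := by gcongr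
        _ = (m - 1 / 2) ^ p * (R * μ ^ j) ^ p := Real.mul_rpow (by linarith) hr.le
        _ ≤ m * μ ^ p * (R * μ ^ j) ^ p := by gcongr
        _ = ∑ _i ∈ s, (μ * (R * μ ^ j)) ^ p := by
            rw [Finset.sum_const, hsc, nsmul_eq_mul, Real.mul_rpow hμ.le hr.le, mul_assoc]
        _ ≤ ∑ i ∈ s, ‖x i‖ ^ p := by
            refine Finset.sum_le_sum fun i hi => ?_
            have := (hκ i (hs i hi).1).1
            rw [(hs i hi).2, pow_succ] at this
            refine Real.rpow_le_rpow (by positivity) ?_ hp0.le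
            linarith
    exact mul_le_mul_of_nonneg_left (Real.rpow_le_rpow (by positivity) hsum (by positivity))
      (by positivity)

/-- A family of vectors of the unit ball for which every choice of signs is approximately attained
by a functional of norm at most one; such a family spans an almost isometric copy of `ℓ₁`. -/
def SignSeparated {X ι : Type*} [NormedAddCommGroup X] [NormedSpace ℝ X] (y : ι → X) : Prop :=
  (∀ j, ‖y j‖ ≤ 1) ∧ ∀ α : ι → ℝ, (∀ j, α j = 1 ∨ α j = -1) →
    ∃ g : StrongDual ℝ X, ‖g‖ ≤ 1 ∧ ∀ j, 1 / 2 ≤ α j * g (y j)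

theorem abs_apply_le_one {X : Type*} [NormedAddCommGroup X] [NormedSpace ℝ X]
    {g : StrongDual ℝ X} (hg : ‖g‖ ≤ 1) {x : X} (hx : ‖x‖ ≤ 1) : |g x| ≤ 1 := by
  have h := g.le_opNorm x
  rw [Real.norm_eq_abs] at h
  nlinarith [norm_nonneg x, norm_nonneg g]

theorem signSeparated_of_lt_norm {X : Type*} [NormedAddCommGroup X] [NormedSpace ℝ X]
    {m : ℕ} {y : Fin m → X} (hy : ∀ j, ‖y j‖ ≤ 1)
    (h : ∀ α : Fin m → ℝ, (∀ j, α j = 1 ∨ α j = -1) → (m : ℝ) - 1 / 2 < ‖∑ j, α j • y j‖) :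
    SignSeparated y := by
  refine ⟨hy, fun α hα => ?_⟩
  obtain ⟨g, hg, hgx⟩ := exists_dual_vector'' ℝ (∑ j, α j • y j)
  refine ⟨g, hg, fun j => ?_⟩
  have hle : ∀ i, α i * g (y i) ≤ 1 := fun i => by
    have := abs_le.1 (abs_apply_le_one hg (hy i))
    rcases hα i with h | h <;> rw [h] <;> linarith [this.1, this.2]
  have h1 := h α hα
  have h2 : g (∑ j, α j • y j) = ∑ j, α j * g (y j) := by simp
  have h3 : ∑ i ∈ Finset.univ.erase j, α i * g (y i) ≤ m - 1 := by
    calc ∑ i ∈ Finset.univ.erase j, α i * g (y i) ≤ ∑ i ∈ Finset.univ.erase j, (1 : ℝ) :=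
          Finset.sum_le_sum fun i _ => hle i
      _ = m - 1 := by
          rw [Finset.sum_const, Finset.card_erase_of_mem (Finset.mem_univ j), Finset.card_univ,
            Fintype.card_fin, nsmul_eq_mul, mul_one, Nat.cast_pred j.pos]
  rw [h2, ← Finset.add_sum_erase _ _ (Finset.mem_univ j)] at hgx
  simp only [RCLike.ofReal_real_eq_id, id_eq] at hgx
  linarith

/-- Sign separated families can be found approximately in the kernel of finitely many
functionals. -/
theorem exists_signSeparated_abs_apply_le {X : Type*} [NormedAddCommGroup X] [NormedSpace ℝ X]
    (h : ∀ m : ℕ, 2 ≤ m → ∃ y : Fin m → X, SignSeparated y) (Φ : Finset (StrongDual ℝ X))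
    (hΦ : ∀ f ∈ Φ, ‖f‖ ≤ 1) {η : ℝ} (hη : 0 < η) (m : ℕ) :
    ∃ z : Fin m → X, SignSeparated z ∧ ∀ f ∈ Φ, ∀ j, |f (z j)| ≤ η := by
  classical
  obtain ⟨t, -, htf, ht⟩ := (isCompact_closedBall (0 : Φ → ℝ) 1).finite_cover_balls hη
  obtain ⟨y, hy⟩ := h (htf.toFinset.card * (2 * m) + 2) (by omega)
  have hcol : ∀ j, ∃ c ∈ t, dist (fun f : Φ => f.1 (y j)) c < η := fun j => by
    have hmem : (fun f : Φ => f.1 (y j)) ∈ Metric.closedBall (0 : Φ → ℝ) 1 := by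
      rw [mem_closedBall_zero_iff, pi_norm_le_iff_of_nonneg zero_le_one]
      exact fun f => abs_apply_le_one (hΦ f.1 f.2) (hy.1 j)
    simpa using ht hmem
  choose col hcolt hcold using hcol
  obtain ⟨c, -, hc⟩ := Finset.exists_lt_card_fiber_of_mul_lt_card_of_maps_to
    (s := Finset.univ) (t := htf.toFinset) (f := col) (n := 2 * m)
    (fun j _ => htf.mem_toFinset.2 (hcolt j)) (by simp)
  set s := Finset.univ.filter fun j => col j = c with hs
  obtain ⟨e⟩ : Nonempty (Fin m × Bool ↪ s) := Function.Embedding.nonempty_of_card_le (by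
    simp only [Fintype.card_prod, Fintype.card_fin, Fintype.card_bool, Fintype.card_coe]
    omega)
  have hes : ∀ q, col (e q).1 = c := fun q => (Finset.mem_filter.1 (e q).2).2
  refine ⟨fun j => (1 / 2 : ℝ) • (y (e (j, true)).1 - y (e (j, false)).1), ⟨fun j => ?_, ?_⟩, ?_⟩
  · rw [norm_smul, Real.norm_of_nonneg (by norm_num)]
    linarith [norm_sub_le (y (e (j, true)).1) (y (e (j, false)).1), hy.1 (e (j, true)).1,
      hy.1 (e (j, false)).1]
  · intro α hα
    obtain ⟨g, hg, hgy⟩ := hy.2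
      (fun i => if ∃ j, (e (j, false)).1 = i then
        -(if hi : ∃ j, (e (j, false)).1 = i then α hi.choose else 1)
        else if hi : ∃ j, (e (j, true)).1 = i then α hi.choose else 1)
      (fun i => by
        split_ifs with h1 h2
        · rcases hα h1.choose with h | h <;> simp [h]
        · exact hα _
        · exact Or.inl rfl)
    refine ⟨g, hg, fun j => ?_⟩
    have inj : ∀ q q', (e q).1 = (e q').1 → q = q' := fun q q' hq =>
      e.injective (Subtype.ext hq)
    have hf : ∃ j', (e (j', false)).1 = (e (j, false)).1 := ⟨j, rfl⟩
    have hfc : hf.choose = j := (Prod.ext_iff.1 (inj _ _ hf.choose_spec)).1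
    have htr : ∃ j', (e (j', true)).1 = (e (j, true)).1 := ⟨j, rfl⟩
    have htc : htr.choose = j := (Prod.ext_iff.1 (inj _ _ htr.choose_spec)).1
    have hnf : ¬ ∃ j', (e (j', false)).1 = (e (j, true)).1 := by
      rintro ⟨j', hj'⟩
      simpa using inj _ _ hj'
    have h1 := hgy (e (j, false)).1
    have h2 := hgy (e (j, true)).1
    rw [if_pos hf, dif_pos hf, hfc] at h1
    rw [if_neg hnf, dif_pos htr, htc] at h2
    rw [map_smul, map_sub, smul_eq_mul]
    linarith
  · intro f hf j
    have hd : ∀ q, |f (y (e q).1) - c ⟨f, hf⟩| < η := fun q => by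
      have := (dist_le_pi_dist _ _ (⟨f, hf⟩ : Φ)).trans_lt (hcold (e q).1)
      rwa [hes q, Real.dist_eq] at this
    have h1 := abs_lt.1 (hd (j, true))
    have h2 := abs_lt.1 (hd (j, false))
    rw [map_smul, map_sub, smul_eq_mul, abs_le]
    constructor <;> linarith [h1.1, h1.2, h2.1, h2.2]

/-- The average of a long sign separated family is far from all averages of few of its members. -/
theorem SignSeparated.le_norm_average_sub {X : Type*} [NormedAddCommGroup X] [NormedSpace ℝ X]
    {N : ℕ} (hN : 0 < N) {y : Fin (8 * N) → X} (hy : SignSeparated y) (b : Fin N → X)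
    (hb : ∀ i, b i ∈ Set.range y ∨ b i = 0) :
    1 / 4 ≤ ‖(1 / (8 * N : ℕ) : ℝ) • ∑ j, y j - (1 / N : ℝ) • ∑ i, b i‖ := by
  classical
  have hex : ∀ i, ∃ k, b i = y k ∨ b i = 0 := fun i => by
    rcases hb i with ⟨k, hk⟩ | h
    · exact ⟨k, Or.inl hk.symm⟩
    · exact ⟨⟨0, by omega⟩, Or.inr h⟩
  choose κ hκ using hex
  set J := Finset.univ.image κ with hJ
  have hJc : J.card ≤ N := Finset.card_image_le.trans (by simp)
  obtain ⟨g, hg, hgy⟩ := hy.2 (fun j => if j ∈ J then -1 else 1)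
    (fun j => by split_ifs <;> simp)
  have hgb : ∀ i, g (b i) ≤ 0 := fun i => by
    rcases hκ i with h | h
    · have := hgy (κ i)
      rw [if_pos (Finset.mem_image_of_mem κ (Finset.mem_univ i)), ← h] at this
      linarith
    · rw [h, map_zero]
  have hgsum : (4 * N : ℝ) - 3 / 2 * N ≤ ∑ j, g (y j) := by
    calc (4 * N : ℝ) - 3 / 2 * N ≤ 4 * N - J.card * (3 / 2) := by
          have : (J.card : ℝ) ≤ N := by exact_mod_cast hJc
          linarith
      _ = ∑ j : Fin (8 * N), ((1 / 2 : ℝ) - if j ∈ J then 3 / 2 else 0) := by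
          rw [Finset.sum_sub_distrib, Finset.sum_ite_mem, Finset.univ_inter]
          simp
          ring
      _ ≤ ∑ j, g (y j) := Finset.sum_le_sum fun j _ => by
          have h1 := hgy j
          have h2 := (abs_le.1 (abs_apply_le_one hg (hy.1 j))).1
          split_ifs at h1 ⊢ <;> linarith
  have hN' : (0 : ℝ) < N := by exact_mod_cast hN
  have h1 : 1 / 4 ≤ (1 / (8 * N : ℕ) : ℝ) * ∑ j, g (y j) := by
    rw [one_div_mul_eq_div, le_div_iff₀ (by positivity)]
    push_cast
    linarith
  have h2 : (1 / N : ℝ) * ∑ i, g (b i) ≤ 0 :=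
    mul_nonpos_of_nonneg_of_nonpos (by positivity) (Finset.sum_nonpos fun i _ => hgb i)
  set w := (1 / (8 * N : ℕ) : ℝ) • ∑ j, y j - (1 / N : ℝ) • ∑ i, b i with hw
  have h3 : g w = (1 / (8 * N : ℕ) : ℝ) * ∑ j, g (y j) - (1 / N : ℝ) * ∑ i, g (b i) := by
    simp only [hw, map_sub, map_smul, map_sum, smul_eq_mul]
  have h4 := (le_abs_self _).trans (g.le_opNorm w)
  nlinarith [norm_nonneg w]

theorem abs_apply_average_le {X : Type*} [NormedAddCommGroup X] [NormedSpace ℝ X]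
    (g : StrongDual ℝ X) {N : ℕ} (hN : 0 < N) (b : Fin N → X) {η : ℝ}
    (hb : ∀ i, |g (b i)| ≤ η) : |g ((1 / N : ℝ) • ∑ i, b i)| ≤ η := by
  have hN' : (0 : ℝ) < N := by exact_mod_cast hN
  rw [map_smul, map_sum, smul_eq_mul, abs_mul, abs_of_nonneg (by positivity),
    one_div_mul_eq_div, div_le_iff₀ hN']
  calc |∑ i, g (b i)| ≤ ∑ i, |g (b i)| := Finset.abs_sum_le_sum_abs _ _
    _ ≤ ∑ _i : Fin N, η := Finset.sum_le_sum fun i _ => hb i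
    _ = η * N := by simp [mul_comm]

theorem exists_finset_average_far {X : Type*} [NormedAddCommGroup X] [NormedSpace ℝ X]
    (h : ∀ m : ℕ, 2 ≤ m → ∃ y : Fin m → X, SignSeparated y) (Φ : Finset (StrongDual ℝ X))
    (hΦ : ∀ f ∈ Φ, ‖f‖ ≤ 1) {η : ℝ} (hη : 0 < η) (k : ℕ) :
    ∃ (A : Finset X) (x : X), (∀ a ∈ A, ‖a‖ ≤ 1) ∧ (∀ f ∈ Φ, ∀ a ∈ A, |f a| ≤ η) ∧
      (∃ y : Fin (8 * (k + 1)) → X, (∀ j, y j ∈ A) ∧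
        x = (1 / (8 * (k + 1) : ℕ) : ℝ) • ∑ j, y j) ∧
      ∀ b : Fin (k + 1) → X, (∀ i, b i ∈ A ∨ b i = 0) →
        1 / 4 ≤ ‖x - (1 / (k + 1 : ℕ) : ℝ) • ∑ i, b i‖ := by
  classical
  obtain ⟨y, hy, hyΦ⟩ := exists_signSeparated_abs_apply_le h Φ hΦ hη (8 * (k + 1))
  refine ⟨Finset.univ.image y, _, ?_, ?_,
    ⟨y, fun j => Finset.mem_image_of_mem y (Finset.mem_univ j), rfl⟩, fun b hb => ?_⟩
  · simpa using hy.1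
  · simpa using hyΦ
  · exact hy.le_norm_average_sub k.succ_pos b fun i => by simpa using hb i

open Classical in
/-- The differences `x - (a 0 + ⋯ + a j) / (j + 1)` of elements of `V`, with `j ≤ k`. -/
noncomputable def averageDifferences {X : Type*} [AddCommGroup X] [Module ℝ X] (k : ℕ)
    (V : Finset X) : Finset X :=
  (Finset.range (k + 1)).biUnion fun j =>
    (V ×ˢ Fintype.piFinset fun _ : Fin (j + 1) => V).image
      fun q => q.1 - (1 / (j + 1 : ℕ) : ℝ) • ∑ i, q.2 i

theorem sub_average_mem_averageDifferences {X : Type*} [AddCommGroup X] [Module ℝ X] {j k : ℕ}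
    (hjk : j ≤ k) {V : Finset X} {x : X} (hx : x ∈ V) {a : Fin (j + 1) → X} (ha : ∀ i, a i ∈ V) :
    x - (1 / (j + 1 : ℕ) : ℝ) • ∑ i, a i ∈ averageDifferences k V := by
  classical
  rw [averageDifferences, Finset.mem_biUnion]
  refine ⟨j, Finset.mem_range.2 (by omega), Finset.mem_image.2 ⟨(x, a), ?_, rfl⟩⟩
  exact Finset.mem_product.2 ⟨hx, Fintype.mem_piFinset.2 ha⟩

/-- The key lower bound: `x` is an average of the block `A`, the vector `u` is built from earlier
blocks, `v` from the block itself and `w` from later blocks. -/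
theorem le_norm_sub_of_almost_annihilated {X : Type*} [NormedAddCommGroup X] [NormedSpace ℝ X]
    {x u v w : X} {g g' : StrongDual ℝ X} {η : ℝ} (hg : ‖g‖ ≤ 1) (hgu : g u = ‖u‖)
    (hg' : ‖g'‖ ≤ 1) (hg'z : g' (x - u - v) = ‖x - u - v‖) (hgx : |g x| ≤ η) (hgv : |g v| ≤ η)
    (hg'w : |g' w| ≤ η) (hxv : 1 / 4 ≤ ‖x - v‖) : 1 / 8 - 2 * η ≤ ‖x - (u + v + w)‖ := by
  have le_norm : ∀ {f : StrongDual ℝ X}, ‖f‖ ≤ 1 → ∀ z, |f z| ≤ ‖z‖ := fun {f} hf z => by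
    have := f.le_opNorm z
    rw [Real.norm_eq_abs] at this
    nlinarith [norm_nonneg z]
  have h1 : ‖x - u - v‖ - η ≤ ‖x - (u + v + w)‖ := by
    have e : x - (u + v + w) = (x - u - v) - w := by abel
    have := (le_abs_self _).trans (le_norm hg' ((x - u - v) - w))
    rw [map_sub, hg'z] at this
    rw [e]
    linarith [(abs_le.1 hg'w).2]
  have h2 : ‖u‖ - 2 * η ≤ ‖x - u - v‖ := by
    have := (neg_le_abs _).trans (le_norm hg (x - u - v))
    rw [map_sub, map_sub, hgu] at this
    linarith [(abs_le.1 hgx).2, (abs_le.1 hgv).1]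
  have h3 : ‖x - v‖ - ‖u‖ ≤ ‖x - u - v‖ := by
    have e : x - u - v = (x - v) - u := by abel
    rw [e]
    exact norm_sub_norm_le _ _
  linarith

/-- If there are sign separated families of every length, some bounded set has averages of many of
its points which are far from all averages of few of its points. -/
theorem exists_set_average_far {X : Type*} [NormedAddCommGroup X] [NormedSpace ℝ X]
    (h : ∀ m : ℕ, 2 ≤ m → ∃ y : Fin m → X, SignSeparated y) :
    ∃ A : Set X, A.Nonempty ∧ (∀ a ∈ A, ‖a‖ ≤ 1) ∧ ∀ k : ℕ,
      ∃ y : Fin (8 * (k + 1)) → X, (∀ j, y j ∈ A) ∧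
        ∀ b : Fin (k + 1) → X, (∀ i, b i ∈ A) →
          1 / 16 ≤ ‖(1 / (8 * (k + 1) : ℕ) : ℝ) • ∑ j, y j
            - (1 / (k + 1 : ℕ) : ℝ) • ∑ i, b i‖ := by
  classical
  choose f hf hfz using fun z : X => exists_dual_vector'' ℝ z
  simp only [RCLike.ofReal_real_eq_id, id_eq] at hfz
  choose A x hA1 hAΦ hAx hAb using fun (k : ℕ) (V : Finset X) =>
    exists_finset_average_far h ((averageDifferences k V).image f)
      (by simpa using fun z _ => hf z) (by norm_num : (0 : ℝ) < 1 / 32) k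
  obtain ⟨V, hVz, hVs⟩ : ∃ V : ℕ → Finset X, V 0 = {0} ∧
      ∀ k, V (k + 1) = insert (x k (V k)) (V k ∪ A k (V k)) :=
    ⟨fun k => Nat.rec {0} (fun k W => insert (x k W) (W ∪ A k W)) k, rfl, fun _ => rfl⟩
  have hVm : Monotone V := monotone_nat_of_le_succ fun k => by
    rw [hVs]
    exact Finset.subset_union_left.trans (Finset.subset_insert _ _)
  have hV0 : ∀ k, 0 ∈ V k := fun k => hVm (Nat.zero_le k) (by simp [hVz])
  have hVA : ∀ k, A k (V k) ⊆ V (k + 1) := fun k => by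
    rw [hVs]
    exact Finset.subset_union_right.trans (Finset.subset_insert _ _)
  have hVx : ∀ k, x k (V k) ∈ V (k + 1) := fun k => by
    rw [hVs]
    exact Finset.mem_insert_self _ _
  choose y hyA hyx using fun k => hAx k (V k)
  refine ⟨⋃ k, (A k (V k) : Set X), ⟨y 0 0, Set.mem_iUnion.2 ⟨0, hyA 0 0⟩⟩, ?_, fun k => ?_⟩
  · intro a ha
    obtain ⟨k, hk⟩ := Set.mem_iUnion.1 ha
    exact hA1 _ _ a hk
  · refine ⟨y k, fun j => Set.mem_iUnion.2 ⟨k, hyA k j⟩, fun b hb => ?_⟩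
    rw [← hyx k]
    set N : ℝ := 1 / (k + 1 : ℕ)
    set b₁ : Fin (k + 1) → X := fun i => if b i ∈ V k then b i else 0 with hb₁
    set b₂ : Fin (k + 1) → X := fun i =>
      if b i ∈ V k then 0 else if b i ∈ A k (V k) then b i else 0 with hb₂
    set b₃ : Fin (k + 1) → X := fun i =>
      if b i ∈ V k then 0 else if b i ∈ A k (V k) then 0 else b i with hb₃
    have hsum : N • ∑ i, b i = N • ∑ i, b₁ i + N • ∑ i, b₂ i + N • ∑ i, b₃ i := by
      rw [← smul_add, ← smul_add, ← Finset.sum_add_distrib, ← Finset.sum_add_distrib]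
      congr 1
      refine Finset.sum_congr rfl fun i _ => ?_
      simp only [hb₁, hb₂, hb₃]
      split_ifs <;> simp
    have hb₁V : ∀ i, b₁ i ∈ V k := fun i => by
      simp only [hb₁]
      split_ifs with h1
      exacts [h1, hV0 k]
    have hb₂A : ∀ i, b₂ i ∈ A k (V k) ∨ b₂ i = 0 := fun i => by
      simp only [hb₂]
      split_ifs with h1 h2
      exacts [Or.inr rfl, Or.inl h2, Or.inr rfl]
    have hb₃A : ∀ i, b₃ i = 0 ∨ ∃ l > k, b₃ i ∈ A l (V l) := fun i => by
      simp only [hb₃]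
      split_ifs with h1 h2
      · exact Or.inl rfl
      · exact Or.inl rfl
      · obtain ⟨l, hl⟩ := Set.mem_iUnion.1 (hb i)
        rcases lt_trichotomy l k with hlk | rfl | hlk
        · exact absurd (hVm hlk (hVA l hl)) h1
        · exact absurd hl h2
        · exact Or.inr ⟨l, hlk, hl⟩
    have hu : 0 - N • ∑ i, b₁ i ∈ averageDifferences k (V k) :=
      sub_average_mem_averageDifferences le_rfl (hV0 k) hb₁V
    have hz : ∀ l > k, x k (V k) - N • ∑ i, b₁ i - N • ∑ i, b₂ i
        ∈ averageDifferences l (V l) := fun l hl => by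
      have hb₁₂ : ∀ i, b₁ i + b₂ i ∈ V l := fun i => by
        simp only [hb₁, hb₂]
        split_ifs with h1 h2
        · rw [add_zero]; exact hVm hl.le h1
        · rw [zero_add]; exact hVm hl (hVA k h2)
        · rw [add_zero]; exact hV0 l
      have := sub_average_mem_averageDifferences hl.le (hVm hl (hVx k)) hb₁₂
      rwa [Finset.sum_add_distrib, smul_add, ← sub_sub] at this
    have hgA : ∀ a ∈ A k (V k), |f (0 - N • ∑ i, b₁ i) a| ≤ 1 / 32 := fun a ha =>
      hAΦ k (V k) _ (Finset.mem_image_of_mem f hu) a ha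
    rw [hsum]
    have key := le_norm_sub_of_almost_annihilated (x := x k (V k)) (u := N • ∑ i, b₁ i)
      (v := N • ∑ i, b₂ i) (w := N • ∑ i, b₃ i) (g := -f (0 - N • ∑ i, b₁ i))
      (g' := f (x k (V k) - N • ∑ i, b₁ i - N • ∑ i, b₂ i)) (η := 1 / 32)
      (by rw [norm_neg]; exact hf _)
      (by
        have := hfz (0 - N • ∑ i, b₁ i)
        rw [zero_sub, norm_neg, map_neg] at this
        rw [neg_apply, zero_sub]
        exact this)
      (hf _) (hfz _)
      (by
        rw [neg_apply, abs_neg, hyx k]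
        exact abs_apply_average_le _ (by omega) _ fun j => hgA _ (hyA k j))
      (by
        rw [neg_apply, abs_neg]
        refine abs_apply_average_le _ k.succ_pos _ fun i => ?_
        rcases hb₂A i with h | h
        · exact hgA _ h
        · rw [h, map_zero, abs_zero]; norm_num)
      (by
        refine abs_apply_average_le _ k.succ_pos _ fun i => ?_
        rcases hb₃A i with h | ⟨l, hl, h⟩
        · rw [h, map_zero, abs_zero]; norm_num
        · exact hAΦ l (V l) _ (Finset.mem_image_of_mem f (hz l hl)) _ h)
      (hAb k (V k) _ hb₂A)
    norm_num at key ⊢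
    exact key

theorem setRiemannSum_const_of_convex {X : Type*} [NormedAddCommGroup X] [NormedSpace ℝ X]
    {K : Set X} (hK : Convex ℝ K) (T : TaggedPartition) : setRiemannSum (fun _ => K) T = K := by
  ext z
  rw [mem_setRiemannSum]
  constructor
  · rintro ⟨a, ha, rfl⟩
    exact hK.sum_mem (fun i _ => T.length_nonneg i) T.sum_length fun i _ => ha i
  · intro hz
    exact ⟨fun _ => z, fun _ => hz, by rw [← Finset.sum_smul, T.sum_length, one_smul]⟩

theorem setRiemannIntegrable_const_of_convex {X : Type*} [NormedAddCommGroup X]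
    [NormedSpace ℝ X] {K : Set X} (hK : Convex ℝ K) (hne : K.Nonempty)
    (hb : Bornology.IsBounded K) : SetRiemannIntegrable fun _ => K := by
  refine ⟨closure K, hne.closure, isClosed_closure, hb.closure, fun ε hε => ⟨1, one_pos, ?_⟩⟩
  intro T _
  rwa [setRiemannSum_const_of_convex hK, Metric.hausdorffDist_self_closure]

/-- For a Riemann integrable constant multifunction, averages of many points of its value are
approximated by averages of a bounded number of points. -/
theorem SetRiemannIntegrable.exists_average_near {X : Type*} [NormedAddCommGroup X]
    [NormedSpace ℝ X] {A : Set X} (hne : A.Nonempty) (hb : Bornology.IsBounded A)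
    (hA : SetRiemannIntegrable fun _ => A) {ε : ℝ} (hε : 0 < ε) :
    ∃ k : ℕ, ∀ M, k < M → ∀ y : Fin M → X, (∀ j, y j ∈ A) →
      ∃ b : Fin (k + 1) → X, (∀ i, b i ∈ A) ∧
        ‖(1 / M : ℝ) • ∑ j, y j - (1 / (k + 1 : ℕ) : ℝ) • ∑ i, b i‖ < ε := by
  obtain ⟨B, hBne, -, hBb, hB⟩ := hA
  obtain ⟨δ, hδ, hT⟩ := hB (ε / 2) (half_pos hε)
  obtain ⟨k, hk⟩ := exists_nat_one_div_lt hδ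
  have hF : IsMultifunction fun _ => A := fun _ _ => ⟨hne, hb⟩
  have htag : ∀ N : ℕ, ∀ i : Fin N, (i : ℝ) / N ∈ Set.Icc ((i : ℝ) / N) (((i : ℝ) + 1) / N) :=
    fun N i => ⟨le_rfl, by gcongr; linarith⟩
  have hfin : ∀ T, Metric.hausdorffEDist (setRiemannSum (fun _ => A) T) B ≠ ⊤ := fun T =>
    Metric.hausdorffEDist_ne_top_of_nonempty_of_bounded (hF.setRiemannSum_nonempty T) hBne
      (hF.isBounded_setRiemannSum T) hBb
  refine ⟨k, fun M hM y hy => ?_⟩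
  have hmem : (1 / M : ℝ) • ∑ j, y j
      ∈ setRiemannSum (fun _ => A) (uniformPartition M (by omega) _ (htag M)) := by
    rw [setRiemannSum_uniformPartition, Set.mem_fintype_sum, Finset.smul_sum]
    exact ⟨_, fun j => Set.smul_mem_smul_set (hy j), rfl⟩
  obtain ⟨z, hz, hyz⟩ := Metric.exists_dist_lt_of_hausdorffDist_lt hmem (hT _ (by
    rw [mesh_uniformPartition]
    refine lt_of_le_of_lt ?_ hk
    have : (k : ℝ) + 1 ≤ M := by exact_mod_cast hM
    gcongr)) (hfin _)
  obtain ⟨w, hw, hwz⟩ := Metric.exists_dist_lt_of_hausdorffDist_lt' hz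
    (hT (uniformPartition (k + 1) k.succ_pos _ (htag (k + 1))) (by
      rw [mesh_uniformPartition]
      exact_mod_cast hk)) (hfin _)
  rw [setRiemannSum_uniformPartition, Set.mem_fintype_sum] at hw
  obtain ⟨c, hc, rfl⟩ := hw
  choose b hbA hbc using hc
  refine ⟨b, hbA, ?_⟩
  rw [← dist_eq_norm, Finset.smul_sum (s := Finset.univ (α := Fin (k + 1)))]
  have e : ∑ i, (1 / (k + 1 : ℕ) : ℝ) • b i = ∑ i, c i := Finset.sum_congr rfl fun i _ => hbc i
  rw [e]
  linarith [dist_triangle_right ((1 / M : ℝ) • ∑ j, y j) (∑ i, c i) z]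

/-- A Banach space `X` has a nontrivial infratype if and only if every multifunction whose
convex hull is Riemann integrable is itself Riemann integrable. -/
theorem stmt9 {X : Type*} [NormedAddCommGroup X] [NormedSpace ℝ X] [CompleteSpace X] :
    (∃ p > (1 : ℝ), ∃ C > (0 : ℝ), HasInfratype X p C) ↔
      (∀ F : ℝ → Set X, IsMultifunction F →
        SetRiemannIntegrable (fun t => convexHull ℝ (F t)) → SetRiemannIntegrable F) := by
  constructor
  · rintro ⟨p, hp, C, hC, h⟩ F hF hconv
    exact h.setRiemannIntegrable hp hC hF hconv
  · intro h
    by_contra hinf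
    have hsep : ∀ m : ℕ, 2 ≤ m → ∃ y : Fin m → X, SignSeparated y := fun m hm => by
      by_contra hno
      refine hinf (exists_hasInfratype_of_forall_exists_signs hm fun y hy => ?_)
      by_contra hy'
      push Not at hy'
      exact hno ⟨y, signSeparated_of_lt_norm hy hy'⟩
    obtain ⟨A, hne, hA1, hfar⟩ := exists_set_average_far hsep
    have hb : Bornology.IsBounded A := isBounded_iff_forall_norm_le.2 ⟨1, hA1⟩
    obtain ⟨k, hk⟩ := (h (fun _ => A) (fun _ _ => ⟨hne, hb⟩)
      (setRiemannIntegrable_const_of_convex (convex_convexHull ℝ A) hne.convexHull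
        (isBounded_convexHull.2 hb))).exists_average_near hne hb
        (by norm_num : (0 : ℝ) < 1 / 16)
    obtain ⟨y, hy, hyb⟩ := hfar k
    obtain ⟨b, hbA, hlt⟩ := hk (8 * (k + 1)) (by omega) y hy
    exact absurd hlt (not_lt.2 (hyb b hbA))
end

section
/- Let X be a real Banach space, let Y ⊆ X be a finite-dimensional subspace, let Z ⊆ X be an infinite-dimensional closed subspace, and let ε ∈ (0,1). Then there exists a subspace G ⊆ Z of finite codimension in Z such that G is ε-orthogonal to Y, i.e. ‖y + g‖ ≥ (1 − ε)‖y‖ for all y ∈ Y and g ∈ G. -/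
/-- If `Y` is a finite-dimensional subspace of a Banach space `X` and `Z` is an
infinite-dimensional closed subspace, then for every `ε ∈ (0,1)` there is a subspace
`G ⊆ Z` of finite codimension in `Z` that is `ε`-orthogonal to `Y`. -/
theorem stmt10 {X : Type*} [NormedAddCommGroup X] [NormedSpace ℝ X] [CompleteSpace X]
    (Y Z : Submodule ℝ X) [FiniteDimensional ℝ Y]
    (hZc : IsClosed (Z : Set X)) (hZinf : ¬ FiniteDimensional ℝ Z)
    (ε : ℝ) (hε : ε ∈ Set.Ioo (0 : ℝ) 1) :
    ∃ G : Submodule ℝ X, G ≤ Z ∧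
      FiniteDimensional ℝ (Z ⧸ Submodule.comap Z.subtype G) ∧
      ∀ y ∈ Y, ∀ g ∈ G, (1 - ε) * ‖y‖ ≤ ‖y + g‖ := by
  obtain ⟨hε0, -⟩ := hε
  choose f hf1 hf using fun y : Y => exists_dual_vector'' ℝ (y : X)
  obtain ⟨t, ht, htfin, hcover⟩ :=
    (isCompact_sphere (0 : Y) 1).finite_cover_balls hε0
  have := htfin.fintype
  let L : X →ₗ[ℝ] (t → ℝ) := LinearMap.pi fun i => (f i : X →ₗ[ℝ] ℝ)
  refine ⟨Z ⊓ LinearMap.ker L, inf_le_left, ?_, ?_⟩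
  · have h : Submodule.comap Z.subtype (Z ⊓ LinearMap.ker L) = LinearMap.ker (L ∘ₗ Z.subtype) := by
      ext x
      simp
    rw [h]
    exact Submodule.CoFG.ker _
  · intro y hy g hg
    rcases eq_or_ne y 0 with rfl | hy0
    · simp
    have hpos : 0 < ‖y‖ := norm_pos_iff.mpr hy0
    let u : Y := ‖y‖⁻¹ • ⟨y, hy⟩
    have hyu : y = ‖y‖ • (u : X) := by simp [u, smul_smul, hpos.ne']
    have hu : u ∈ Metric.sphere (0 : Y) 1 := by
      simp [u, norm_smul, hpos.ne']
    obtain ⟨i, hit, hui⟩ : ∃ i ∈ t, u ∈ Metric.ball i ε := by simpa using hcover hu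
    have hg0 : f i g = 0 := congrFun (LinearMap.mem_ker.mp hg.2) ⟨i, hit⟩
    have hle : ∀ x, |f i x| ≤ ‖x‖ := fun x => by
      simpa using (f i).le_of_opNorm_le (hf1 i) x
    have hi : f i i = 1 := by
      have h := ht hit
      rw [mem_sphere_zero_iff_norm] at h
      exact (hf i).trans (congrArg _ h)
    have hclose : ‖(u : X) - i‖ < ε := by
      simpa [dist_eq_norm] using hui
    have hfu : 1 - ε ≤ f i u := by
      have h := neg_le_of_abs_le (hle ((u : X) - i))
      rw [map_sub, hi] at h
      linarith
    calc (1 - ε) * ‖y‖ ≤ ‖y‖ * f i u := by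
          rw [mul_comm]
          gcongr
      _ = f i y := by
          conv_rhs => rw [hyu]
          simp
      _ = f i (y + g) := by simp [hg0]
      _ ≤ ‖y + g‖ := le_of_abs_le (hle _)
end

section
/- Let X be a real Banach space, let ε ∈ (0,1), and suppose the subspace G of X is ε-orthogonal to the subspace E, i.e. ‖e + g‖ ≥ (1 − ε)‖e‖ for all e ∈ E and g ∈ G. Then E is 1/(2−ε)-orthogonal to G: for all e ∈ E and g ∈ G, ‖e + g‖ ≥ (1 − 1/(2−ε)) ‖g‖. -/
/-- If the subspace `G` is `ε`-orthogonal to the subspace `E`, then `E` is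
`1/(2-ε)`-orthogonal to `G`. -/
theorem stmt11 {X : Type*} [NormedAddCommGroup X] [NormedSpace ℝ X]
    (E G : Submodule ℝ X) (ε : ℝ) (hε : ε ∈ Set.Ioo (0 : ℝ) 1)
    (h : ∀ e ∈ E, ∀ g ∈ G, (1 - ε) * ‖e‖ ≤ ‖e + g‖) :
    ∀ e ∈ E, ∀ g ∈ G, (1 - 1 / (2 - ε)) * ‖g‖ ≤ ‖e + g‖ := by
  intro e he g hg
  have hpos : 0 < 2 - ε := by linarith [hε.2]
  have hcoef : 1 - 1 / (2 - ε) = (1 - ε) / (2 - ε) := by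
    field_simp
    ring
  have htri : ‖g‖ ≤ ‖e + g‖ + ‖e‖ := by
    simpa using norm_sub_le (e + g) e
  rw [hcoef, div_mul_eq_mul_div, div_le_iff₀ hpos]
  linarith [h e he g hg, mul_le_mul_of_nonneg_left htri (sub_nonneg.2 hε.2.le)]
end

section
/- Let X be a real Banach space having no non-trivial infratype, i.e. for every p > 1 and every C > 0, X fails to have infratype p with constant C. Then for every ε ∈ (0,1) there exist sequences of subspaces {E_k}_{k≥1} and {G_k}_{k≥0} of X such that for all k ≥ 1: (i) dim E_k = 2^{k−1} and G_k has finite codimension in X; (ii) G_0 ⊇ G_1 ⊇ G_2 ⊇ …; (iii) E_k ⊆ G_{k−1}; (iv) there is a linear isomorphism T_k from ℓ₁^{(2^{k−1})} (ℝ^{2^{k−1}} with the ℓ₁-norm) onto E_k with ‖T_k‖·‖T_k^{−1}‖ < 2; (v) G_k is ε-orthogonal to E_1 + E_2 + … + E_k. -/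
open Pointwise

/-- Signs available for `κ`-families in the unit ball are available for subfamilies of cardinality
`card κ` of a ball of any radius. -/
theorem exists_signs_finset {X ι κ : Type*} [NormedAddCommGroup X] [NormedSpace ℝ X]
    [Fintype κ] {c R : ℝ} (hR : 0 < R)
    (H : ∀ x : κ → X, (∀ i, ‖x i‖ ≤ 1) →
      ∃ α : κ → ℝ, (∀ i, α i = 1 ∨ α i = -1) ∧ ‖∑ i, α i • x i‖ ≤ c)
    (t : Finset ι) (ht : t.card = Fintype.card κ) (x : ι → X) (hx : ∀ i ∈ t, ‖x i‖ ≤ R) :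
    ∃ α : ι → ℝ, (∀ i, α i = 1 ∨ α i = -1) ∧ ‖∑ i ∈ t, α i • x i‖ ≤ c * R := by
  classical
  let e : t ≃ κ := Fintype.equivOfCardEq (by simpa using ht)
  obtain ⟨α, hα, hs⟩ := H (fun k => R⁻¹ • x (e.symm k)) (fun k => by
    rw [norm_smul, norm_inv, Real.norm_of_nonneg hR.le, inv_mul_le_iff₀ hR, mul_one]
    exact hx _ (e.symm k).2)
  refine ⟨fun i => if h : i ∈ t then α (e ⟨i, h⟩) else 1, fun i => ?_, ?_⟩
  · by_cases h : i ∈ t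
    · simpa [h] using hα _
    · simp [h]
  · have h1 : ∑ i ∈ t, (if h : i ∈ t then α (e ⟨i, h⟩) else 1) • x i
        = R • ∑ k, α k • R⁻¹ • x (e.symm k) := by
      rw [← Finset.sum_coe_sort, Finset.smul_sum, ← e.sum_comp]
      refine Finset.sum_congr rfl fun i _ => ?_
      rw [smul_comm (α _), smul_inv_smul₀ hR.ne']
      simp
    rw [h1, norm_smul, Real.norm_of_nonneg hR.le, mul_comm]
    gcongr

/-- If at most `n` of the vectors have norm in any given interval `[θR, R]`, then the sum of the
norms is controlled by the largest one. -/
theorem sum_norm_le_of_card_filter_le {X ι : Type*} [NormedAddCommGroup X] {n : ℕ} {θ M : ℝ}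
    (hθ : 0 < θ) (hθ1 : θ < 1) (hM : 0 ≤ M) (s : Finset ι) (x : ι → X)
    (hx : ∀ i ∈ s, ‖x i‖ ≤ M)
    (h : ∀ R > 0, (s.filter fun i => θ * R ≤ ‖x i‖ ∧ ‖x i‖ ≤ R).card ≤ n) :
    ∑ i ∈ s, ‖x i‖ ≤ n / (1 - θ) * M := by
  classical
  rcases hM.eq_or_lt with rfl | hM
  · simpa using Finset.sum_nonpos hx
  have key : ∀ i, ∃ k : ℕ, i ∈ s → x i ≠ 0 → θ ^ (k + 1) * M < ‖x i‖ ∧ ‖x i‖ ≤ θ ^ k * M := by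
    intro i
    by_cases hi : i ∈ s ∧ x i ≠ 0
    · obtain ⟨k, hk1, hk2⟩ := exists_nat_pow_near_of_lt_one (x := ‖x i‖ / M) (y := θ)
        (by have := norm_pos_iff.2 hi.2; positivity)
        ((div_le_one hM).2 (hx i hi.1)) hθ hθ1
      exact ⟨k, fun _ _ => ⟨(lt_div_iff₀ hM).1 hk1, (div_le_iff₀ hM).1 hk2⟩⟩
    · exact ⟨0, fun h1 h2 => absurd ⟨h1, h2⟩ hi⟩
  choose k hk using key
  set s' := s.filter fun i => x i ≠ 0 with hs'
  have e1 : ∑ i ∈ s, ‖x i‖ = ∑ i ∈ s', ‖x i‖ := by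
    rw [hs', Finset.sum_filter_of_ne]
    intro i _ hi; simpa using hi
  rw [e1, ← Finset.sum_fiberwise_of_maps_to (g := k) (t := s'.image k)
    (fun i hi => Finset.mem_image_of_mem _ hi)]
  calc ∑ j ∈ s'.image k, ∑ i ∈ s' with k i = j, ‖x i‖
      ≤ ∑ j ∈ s'.image k, n * M * θ ^ j := by
        refine Finset.sum_le_sum fun j _ => ?_
        have hR : 0 < θ ^ j * M := by positivity
        have hfib : (s'.filter fun i => k i = j).card ≤ n := by
          refine le_trans (Finset.card_le_card fun i hi => ?_) (h _ hR)
          simp only [hs', Finset.mem_filter] at hi ⊢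
          obtain ⟨⟨h1, h2⟩, rfl⟩ := hi
          have := hk i h1 h2
          refine ⟨h1, ?_, this.2⟩
          rw [← mul_assoc, ← pow_succ']; exact this.1.le
        calc ∑ i ∈ s' with k i = j, ‖x i‖ ≤ ∑ i ∈ s' with k i = j, θ ^ j * M := by
              refine Finset.sum_le_sum fun i hi => ?_
              simp only [hs', Finset.mem_filter] at hi
              obtain ⟨⟨h1, h2⟩, rfl⟩ := hi
              exact (hk i h1 h2).2
          _ = (s'.filter fun i => k i = j).card * (θ ^ j * M) := by simp
          _ ≤ n * (θ ^ j * M) := by gcongr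
          _ = n * M * θ ^ j := by ring
    _ = n * M * ∑ j ∈ s'.image k, θ ^ j := by rw [Finset.mul_sum]
    _ ≤ n * M * (1 - θ)⁻¹ := by
        gcongr
        rw [← tsum_geometric_of_lt_one hθ.le hθ1]
        exact (summable_geometric_of_lt_one hθ.le hθ1).sum_le_tsum _ fun _ _ => by positivity
    _ = n / (1 - θ) * M := by ring

/-- If every `κ`-family in the unit ball has a signed sum of norm at most `c`, where
`c ^ p ≤ card κ * θ ^ p`, then merging `card κ` vectors of comparable norm does not increase
`∑ ‖x i‖ ^ p`, and iterating this yields infratype `p`. -/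
theorem exists_signs_norm_sum_le {X ι κ : Type*} [NormedAddCommGroup X] [NormedSpace ℝ X]
    [Fintype κ] (hκ : 2 ≤ Fintype.card κ) {c θ p : ℝ} (hθ : 0 < θ) (hθ1 : θ < 1) (hp : 1 < p)
    (hc : 0 ≤ c) (hcp : c ^ p ≤ Fintype.card κ * θ ^ p)
    (H : ∀ x : κ → X, (∀ i, ‖x i‖ ≤ 1) →
      ∃ α : κ → ℝ, (∀ i, α i = 1 ∨ α i = -1) ∧ ‖∑ i, α i • x i‖ ≤ c)
    (s : Finset ι) (x : ι → X) :
    ∃ α : ι → ℝ, (∀ i, α i = 1 ∨ α i = -1) ∧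
      ‖∑ i ∈ s, α i • x i‖ ≤
        Fintype.card κ / (1 - θ) * (∑ i ∈ s, ‖x i‖ ^ p) ^ (1 / p) := by
  classical
  have hp0 : 0 < p := by linarith
  have h1θ : 0 < 1 - θ := by linarith
  induction hN : s.card using Nat.strong_induction_on generalizing s x with
  | _ N ih =>
  by_cases hcl : ∀ R > 0, (s.filter fun i => θ * R ≤ ‖x i‖ ∧ ‖x i‖ ≤ R).card ≤ Fintype.card κ
  · refine ⟨fun _ => 1, fun _ => Or.inl rfl, ?_⟩
    simp only [one_smul]
    refine (norm_sum_le _ _).trans (sum_norm_le_of_card_filter_le hθ hθ1 (by positivity) s x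
      (fun i hi => ?_) hcl)
    rw [one_div, Real.le_rpow_inv_iff_of_pos (norm_nonneg _) (by positivity) hp0]
    exact Finset.single_le_sum (f := fun i => ‖x i‖ ^ p) (fun _ _ => by positivity) hi
  push Not at hcl
  obtain ⟨R, hR, hcard⟩ := hcl
  obtain ⟨t, hts, htc⟩ := Finset.exists_subset_card_eq hcard.le
  have htx : ∀ i ∈ t, i ∈ s ∧ θ * R ≤ ‖x i‖ ∧ ‖x i‖ ≤ R := fun i hi => by
    simpa using hts hi
  have hts' : t ⊆ s := fun i hi => (htx i hi).1
  obtain ⟨β, hβ, hβs⟩ := exists_signs_finset hR H t htc x fun i hi => (htx i hi).2.2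
  obtain ⟨i₀, hi₀⟩ : t.Nonempty := Finset.card_pos.1 (by omega)
  set y := ∑ i ∈ t, β i • x i with hy
  have hi₀' : i₀ ∉ s \ t := by simp [hi₀]
  obtain ⟨α, hα, hαs⟩ := ih (insert i₀ (s \ t)).card (by
    rw [Finset.card_insert_of_notMem hi₀', Finset.card_sdiff_of_subset hts']
    have := Finset.card_le_card hts'
    omega) (insert i₀ (s \ t)) (Function.update x i₀ y) rfl
  have hne : ∀ i ∈ s \ t, i ≠ i₀ := fun i hi h => hi₀' (h ▸ hi)
  refine ⟨fun i => if i ∈ t then α i₀ * β i else α i, fun i => ?_, ?_⟩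
  · by_cases h : i ∈ t
    · rcases hα i₀ with h1 | h1 <;> rcases hβ i with h2 | h2 <;> simp [h, h1, h2]
    · simpa [h] using hα i
  · have e1 : ∑ i ∈ s, (if i ∈ t then α i₀ * β i else α i) • x i
        = ∑ i ∈ insert i₀ (s \ t), α i • Function.update x i₀ y i := by
      rw [Finset.sum_insert hi₀', ← Finset.sum_sdiff hts', add_comm]
      congr 1
      · rw [Function.update_self, hy, Finset.smul_sum]
        exact Finset.sum_congr rfl fun i hi => by simp [hi, mul_smul]
      · exact Finset.sum_congr rfl fun i hi => by
          rw [Function.update_of_ne (hne i hi), if_neg (Finset.mem_sdiff.1 hi).2]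
    rw [e1]
    refine hαs.trans ?_
    gcongr
    rw [Finset.sum_insert hi₀', ← Finset.sum_sdiff hts', add_comm]
    refine add_le_add (le_of_eq ?_) ?_
    · exact Finset.sum_congr rfl fun i hi => by rw [Function.update_of_ne (hne i hi)]
    · rw [Function.update_self]
      calc ‖y‖ ^ p ≤ (c * R) ^ p := by gcongr
        _ = c ^ p * R ^ p := Real.mul_rpow hc hR.le
        _ ≤ Fintype.card κ * θ ^ p * R ^ p := by gcongr
        _ = ∑ i ∈ t, (θ * R) ^ p := by
          rw [Real.mul_rpow hθ.le hR.le]; simp [htc, mul_assoc]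
        _ ≤ _ := Finset.sum_le_sum fun i hi => by
          have := (htx i hi).2.1
          gcongr

theorem hasInfratype_of_exists_signs {X κ : Type*} [NormedAddCommGroup X] [NormedSpace ℝ X]
    [Fintype κ] (hκ : 2 ≤ Fintype.card κ) {c : ℝ} (hc : c < Fintype.card κ)
    (H : ∀ x : κ → X, (∀ i, ‖x i‖ ≤ 1) →
      ∃ α : κ → ℝ, (∀ i, α i = 1 ∨ α i = -1) ∧ ‖∑ i, α i • x i‖ ≤ c) :
    ∃ p C : ℝ, 1 < p ∧ 0 < C ∧ HasInfratype X p C := by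
  have hn : (2 : ℝ) ≤ Fintype.card κ := by exact_mod_cast hκ
  wlog hc0 : 0 < c generalizing c
  · refine this (c := 1) (by linarith) (fun x hx => ?_) one_pos
    obtain ⟨α, hα, h⟩ := H x hx
    exact ⟨α, hα, by linarith⟩
  obtain ⟨θ, hθc, hθ1⟩ := exists_between ((div_lt_one (by linarith)).2 hc)
  have hθ : 0 < θ := lt_of_le_of_lt (by positivity) hθc
  rw [div_lt_iff₀ (by linarith)] at hθc
  have hev : ∀ᶠ p : ℝ in nhds 1, c ^ p < Fintype.card κ * θ ^ p := by
    refine ContinuousAt.eventually_lt (Real.continuousAt_const_rpow hc0.ne')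
      ((Real.continuousAt_const_rpow hθ.ne').const_mul _) ?_
    simpa [mul_comm] using hθc
  obtain ⟨p, hcp, hp⟩ := ((hev.filter_mono nhdsWithin_le_nhds).and
    (self_mem_nhdsWithin (s := Set.Ioi (1 : ℝ)))).exists
  have h1θ : 0 < 1 - θ := by linarith
  exact ⟨p, Fintype.card κ / (1 - θ), hp, by positivity, fun n x =>
    exists_signs_norm_sum_le hκ hθ hθ1 hp hc0.le hcp.le H Finset.univ x⟩

/-- A family in the unit ball all of whose signed sums have almost maximal norm satisfies a lower
`ℓ₁` estimate. -/
theorem mul_sum_abs_le_norm_sum {X κ : Type*} [NormedAddCommGroup X] [NormedSpace ℝ X]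
    [Fintype κ] {δ : ℝ} (hδ : 0 ≤ δ) {x : κ → X} (hx : ∀ i, ‖x i‖ ≤ 1)
    (h : ∀ α : κ → ℝ, (∀ i, α i = 1 ∨ α i = -1) → Fintype.card κ - δ ≤ ‖∑ i, α i • x i‖)
    (a : κ → ℝ) : (1 - δ) * ∑ i, |a i| ≤ ‖∑ i, a i • x i‖ := by
  rcases isEmpty_or_nonempty κ with hκ | hκ
  · simp
  obtain ⟨i₀, -, hi₀⟩ := Finset.exists_max_image Finset.univ (fun i => |a i|)
    Finset.univ_nonempty
  set A := |a i₀| with hA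
  have hA0 : 0 ≤ A := abs_nonneg _
  have hA1 : A ≤ ∑ i, |a i| :=
    Finset.single_le_sum (f := fun i => |a i|) (fun _ _ => abs_nonneg _) (Finset.mem_univ i₀)
  let α : κ → ℝ := fun i => if 0 ≤ a i then 1 else -1
  have hα : ∀ i, α i = 1 ∨ α i = -1 := fun i => by
    by_cases hi : 0 ≤ a i <;> simp [α, hi]
  have hdiff : ‖∑ i, (A * α i - a i) • x i‖ ≤ ∑ i, (A - |a i|) := by
    refine norm_sum_le_of_le _ fun i hi => ?_
    have h1 : ‖A * α i - a i‖ = A - |a i| := by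
      have hi' : |a i| ≤ A := hi₀ i hi
      rw [Real.norm_eq_abs]
      by_cases h0 : 0 ≤ a i
      · rw [abs_of_nonneg h0] at hi' ⊢
        simp only [α, h0, if_true, mul_one]
        exact abs_of_nonneg (by linarith)
      · have h0' : a i < 0 := not_le.1 h0
        rw [abs_of_neg h0'] at hi' ⊢
        simp only [α, h0, if_false]
        rw [abs_of_nonpos (by linarith)]
        ring
    rw [norm_smul, h1]
    exact mul_le_of_le_one_right (h1 ▸ norm_nonneg _) (hx i)
  have hsum : A • ∑ i, α i • x i = ∑ i, a i • x i + ∑ i, (A * α i - a i) • x i := by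
    rw [← Finset.sum_add_distrib, Finset.smul_sum]
    exact Finset.sum_congr rfl fun i _ => by rw [← add_smul, smul_smul]; simp
  have hnorm : A * ‖∑ i, α i • x i‖ ≤ ‖∑ i, a i • x i‖ + ∑ i, (A - |a i|) := by
    rw [← Real.norm_of_nonneg hA0, ← norm_smul, Real.norm_of_nonneg hA0, hsum]
    exact (norm_add_le _ _).trans (by gcongr)
  have := mul_le_mul_of_nonneg_left (h α hα) hA0
  have h3 := mul_le_mul_of_nonneg_left hA1 hδ
  rw [Finset.sum_sub_distrib, Finset.sum_const, Finset.card_univ, nsmul_eq_mul] at hnorm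
  linarith

theorem exists_almost_isometric_l1 {X : Type*} [NormedAddCommGroup X] [NormedSpace ℝ X]
    (hX : ∀ p C : ℝ, 1 < p → 0 < C → ¬ HasInfratype X p C)
    (κ : Type*) [Fintype κ] (hκ : 2 ≤ Fintype.card κ) {δ : ℝ} (hδ : 0 < δ) :
    ∃ x : κ → X, (∀ i, ‖x i‖ ≤ 1) ∧
      ∀ a : κ → ℝ, (1 - δ) * ∑ i, |a i| ≤ ‖∑ i, a i • x i‖ := by
  by_contra! hcon
  obtain ⟨p, C, hp, hC, h⟩ := hasInfratype_of_exists_signs (X := X) hκ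
    (c := Fintype.card κ - δ) (by linarith) (fun x hx => by
      by_contra! hx'
      obtain ⟨a, ha⟩ := hcon x hx
      exact absurd (mul_sum_abs_le_norm_sum hδ.le hx (fun α hα => (hx' α hα).le) a)
        (not_le.2 ha))
  exact hX p C hp hC h

/-- Without nontrivial infratype, every subspace of finite codimension contains almost isometric
copies of the unit vector basis of `ℓ₁`: combine blocks of vectors of a longer such family in `X`
so as to land in the subspace. -/
theorem exists_almost_isometric_l1_mem {X : Type*} [NormedAddCommGroup X] [NormedSpace ℝ X]
    (hX : ∀ p C : ℝ, 1 < p → 0 < C → ¬ HasInfratype X p C)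
    (G : Submodule ℝ X) [FiniteDimensional ℝ (X ⧸ G)]
    (ι : Type*) [Fintype ι] [Nonempty ι] {δ : ℝ} (hδ : 0 < δ) :
    ∃ u : ι → X, (∀ i, u i ∈ G) ∧ (∀ i, ‖u i‖ ≤ 1) ∧
      ∀ b : ι → ℝ, (1 - δ) * ∑ i, |b i| ≤ ‖∑ i, b i • u i‖ := by
  set d := Module.finrank ℝ (X ⧸ G) with hd
  obtain ⟨x, hx, hlow⟩ := exists_almost_isometric_l1 hX (ι × Fin (d + 2)) (by
    have : 0 < Fintype.card ι := Fintype.card_pos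
    rw [Fintype.card_prod, Fintype.card_fin]; nlinarith) hδ
  have key : ∀ i, ∃ a : Fin (d + 2) → ℝ, ∑ j, |a j| = 1 ∧ ∑ j, a j • x (i, j) ∈ G := by
    intro i
    have hli : ¬ LinearIndependent ℝ fun j => G.mkQ (x (i, j)) := fun h => by
      have := h.fintype_card_le_finrank
      rw [Fintype.card_fin] at this; omega
    obtain ⟨a, ha, j, hj⟩ := Fintype.not_linearIndependent_iff.1 hli
    set S := ∑ j, |a j| with hS
    have hS0 : 0 < S :=
      Finset.sum_pos' (fun _ _ => abs_nonneg _) ⟨j, Finset.mem_univ j, abs_pos.2 hj⟩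
    refine ⟨fun j => S⁻¹ * a j, ?_, ?_⟩
    · simp_rw [abs_mul]
      rw [← Finset.mul_sum, ← hS, abs_of_pos (inv_pos.2 hS0), inv_mul_cancel₀ hS0.ne']
    · simp_rw [mul_smul]
      rw [← Finset.smul_sum]
      refine G.smul_mem _ ?_
      rw [← Submodule.Quotient.mk_eq_zero, ← Submodule.mkQ_apply, map_sum]
      simpa using ha
  choose a ha hG using key
  refine ⟨fun i => ∑ j, a i j • x (i, j), hG, fun i => ?_, fun b => ?_⟩
  · rw [← ha i]
    refine norm_sum_le_of_le _ fun j _ => ?_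
    rw [norm_smul, Real.norm_eq_abs]
    exact mul_le_of_le_one_right (abs_nonneg _) (hx _)
  · have h := hlow fun q => b q.1 * a q.1 q.2
    simp_rw [Fintype.sum_prod_type, abs_mul, ← Finset.mul_sum, ha, mul_one, mul_smul,
      ← Finset.smul_sum] at h
    exact h

theorem exists_l1_submodule_le {X : Type*} [NormedAddCommGroup X] [NormedSpace ℝ X]
    (hX : ∀ p C : ℝ, 1 < p → 0 < C → ¬ HasInfratype X p C)
    (G : Submodule ℝ X) [FiniteDimensional ℝ (X ⧸ G)]
    (ι : Type*) [Fintype ι] [Nonempty ι] :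
    ∃ E : Submodule ℝ X, E ≤ G ∧ Module.finrank ℝ E = Fintype.card ι ∧
      ∃ T : PiLp 1 (fun _ : ι => ℝ) ≃L[ℝ] E,
        ‖(T : PiLp 1 (fun _ : ι => ℝ) →L[ℝ] E)‖ *
          ‖(T.symm : E →L[ℝ] PiLp 1 (fun _ : ι => ℝ))‖ < 2 := by
  obtain ⟨u, huG, hu, hlow⟩ := exists_almost_isometric_l1_mem hX G ι (δ := 1 / 3) (by norm_num)
  let L : PiLp 1 (fun _ : ι => ℝ) →ₗ[ℝ] X :=
    Fintype.linearCombination ℝ u ∘ₗ (WithLp.linearEquiv 1 ℝ (ι → ℝ)).toLinearMap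
  have hL : ∀ b, L b = ∑ i, b i • u i := fun b => by
    simp [L, Fintype.linearCombination_apply]
  have hnorm : ∀ b : PiLp 1 (fun _ : ι => ℝ), ‖b‖ = ∑ i, |b i| := fun b => by
    simp [PiLp.norm_eq_of_nat 1 (by simp) b]
  have hLlow : ∀ b, ‖b‖ ≤ 3 / 2 * ‖L b‖ := fun b => by
    rw [hnorm, hL]
    linarith [hlow b]
  have hLup : ∀ b, ‖L b‖ ≤ 1 * ‖b‖ := fun b => by
    rw [hnorm, hL, one_mul]
    refine norm_sum_le_of_le _ fun i _ => ?_
    rw [norm_smul, Real.norm_eq_abs]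
    exact mul_le_of_le_one_right (abs_nonneg _) (hu _)
  have hinj : Function.Injective L := (injective_iff_map_eq_zero L).2 fun b hb => by
    have := hLlow b
    rw [hb, norm_zero, mul_zero] at this
    exact norm_le_zero_iff.1 this
  let T := (LinearEquiv.ofInjective L hinj).toContinuousLinearEquiv
  have hT : ∀ b, (T b : X) = L b := fun b => rfl
  refine ⟨LinearMap.range L, ?_, ?_, T, ?_⟩
  · rintro _ ⟨b, rfl⟩
    rw [hL]
    exact G.sum_mem fun i _ => G.smul_mem _ (huG i)
  · rw [LinearMap.finrank_range_of_inj hinj, (WithLp.linearEquiv 1 ℝ (ι → ℝ)).finrank_eq,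
      Module.finrank_fintype_fun_eq_card]
  · have h1 : ‖(T : PiLp 1 (fun _ : ι => ℝ) →L[ℝ] LinearMap.range L)‖ ≤ 1 :=
      ContinuousLinearMap.opNorm_le_bound _ zero_le_one fun b => hLup b
    have h2 : ‖(T.symm : LinearMap.range L →L[ℝ] PiLp 1 (fun _ : ι => ℝ))‖ ≤ 3 / 2 :=
      ContinuousLinearMap.opNorm_le_bound _ (by norm_num) fun y => by
        obtain ⟨b, rfl⟩ := T.surjective y
        have := hLlow b
        rw [← hT] at this
        simpa using this
    have := mul_le_mul h1 h2 (ContinuousLinearMap.opNorm_nonneg _) zero_le_one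
    linarith

/-- Mazur's lemma: every finite-dimensional subspace admits an `ε`-orthogonal subspace of finite
codimension. -/
theorem exists_cofinite_orthogonal {X : Type*} [NormedAddCommGroup X] [NormedSpace ℝ X]
    {ε : ℝ} (hε : 0 < ε) (F : Submodule ℝ X) [FiniteDimensional ℝ F] :
    ∃ M : Submodule ℝ X, FiniteDimensional ℝ (X ⧸ M) ∧
      ∀ y ∈ F, ∀ g ∈ M, (1 - ε) * ‖y‖ ≤ ‖y + g‖ := by
  have : ProperSpace F := FiniteDimensional.proper_real F
  obtain ⟨t, hts, ht, hcov⟩ := (isCompact_sphere (0 : F) 1).finite_cover_balls hε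
  choose f hf1 hf using fun y : F => exists_dual_vector'' ℝ (y : X)
  have := ht.fintype
  let Φ : X →ₗ[ℝ] (t → ℝ) := LinearMap.pi fun y => (f y : X →ₗ[ℝ] ℝ)
  refine ⟨LinearMap.ker Φ, Module.Finite.equiv Φ.quotKerEquivRange.symm, fun y hy g hg => ?_⟩
  rcases eq_or_ne y 0 with rfl | hy0
  · simp
  have hy0' : 0 < ‖y‖ := norm_pos_iff.2 hy0
  let v : F := ‖y‖⁻¹ • ⟨y, hy⟩
  have hv : v ∈ Metric.sphere (0 : F) 1 := by
    simp [v, norm_smul, hy0]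
  obtain ⟨z, hz, hvz⟩ := Set.mem_iUnion₂.1 (hcov hv)
  have hfg : f z g = 0 := congrFun hg ⟨z, hz⟩
  have hz1 : ‖(z : X)‖ = 1 := by simpa using hts hz
  have hle : ∀ w : X, f z w ≤ ‖w‖ := fun w =>
    (le_abs_self _).trans (((f z).le_of_opNorm_le (hf1 z) w).trans (one_mul _).le)
  have hclose : ‖(z : X) - v‖ < ε := by
    rw [Metric.mem_ball, dist_comm, dist_eq_norm] at hvz
    exact hvz
  have hfv : 1 - ε ≤ f z v := by
    have h1 := hle ((z : X) - v)
    have h2 : f z z = 1 := (hf z).trans hz1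
    rw [map_sub, h2] at h1
    linarith
  have hyv : y = ‖y‖ • (v : X) := by simp [v, smul_inv_smul₀ hy0'.ne']
  calc (1 - ε) * ‖y‖ ≤ f z v * ‖y‖ := by gcongr
    _ = f z (y + g) := by
      rw [map_add, hfg, add_zero]
      conv_rhs => rw [hyv, map_smul, smul_eq_mul, mul_comm]
    _ ≤ ‖y + g‖ := hle _

/-- In a Banach space without nontrivial infratype, for every `ε ∈ (0,1)` there are
sequences of subspaces `E k` (playing the role of `E_{k+1}` of the paper, of dimension
`2^k` and `2`-isomorphic to `ℓ₁^{2^k}`) and `G k` (of finite codimension, decreasing,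
`G 0 = X`, with `E k ⊆ G k`) such that `G (k+1)` is `ε`-orthogonal to `E 0 + … + E k`. -/
theorem stmt12 {X : Type*} [NormedAddCommGroup X] [NormedSpace ℝ X] [CompleteSpace X]
    (hX : ∀ p C : ℝ, 1 < p → 0 < C → ¬ HasInfratype X p C)
    (ε : ℝ) (hε : ε ∈ Set.Ioo (0 : ℝ) 1) :
    ∃ E G : ℕ → Submodule ℝ X,
      G 0 = ⊤ ∧
      (∀ k, Module.finrank ℝ (E k) = 2 ^ k) ∧
      (∀ k, FiniteDimensional ℝ (X ⧸ G k)) ∧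
      Antitone G ∧
      (∀ k, E k ≤ G k) ∧
      (∀ k, ∃ T : PiLp 1 (fun _ : Fin (2 ^ k) => ℝ) ≃L[ℝ] E k,
        ‖(T : PiLp 1 (fun _ : Fin (2 ^ k) => ℝ) →L[ℝ] E k)‖ *
          ‖(T.symm : E k →L[ℝ] PiLp 1 (fun _ : Fin (2 ^ k) => ℝ))‖ < 2) ∧
      (∀ k, ∀ y ∈ (Finset.range (k + 1)).sup E, ∀ g ∈ G (k + 1),
        (1 - ε) * ‖y‖ ≤ ‖y + g‖) := by
  have hE : ∀ (k : ℕ) (G : Submodule ℝ X), ∃ E : Submodule ℝ X, FiniteDimensional ℝ (X ⧸ G) →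
      E ≤ G ∧ Module.finrank ℝ E = 2 ^ k ∧
      ∃ T : PiLp 1 (fun _ : Fin (2 ^ k) => ℝ) ≃L[ℝ] E,
        ‖(T : PiLp 1 (fun _ : Fin (2 ^ k) => ℝ) →L[ℝ] E)‖ *
          ‖(T.symm : E →L[ℝ] PiLp 1 (fun _ : Fin (2 ^ k) => ℝ))‖ < 2 := fun k G => by
    by_cases hG : FiniteDimensional ℝ (X ⧸ G)
    · obtain ⟨E, hE⟩ := exists_l1_submodule_le hX G (Fin (2 ^ k))
      rw [Fintype.card_fin] at hE
      exact ⟨E, fun _ => hE⟩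
    · exact ⟨⊥, fun h => absurd h hG⟩
  have hM : ∀ F : Submodule ℝ X, ∃ M : Submodule ℝ X, FiniteDimensional ℝ F →
      FiniteDimensional ℝ (X ⧸ M) ∧ ∀ y ∈ F, ∀ g ∈ M, (1 - ε) * ‖y‖ ≤ ‖y + g‖ := fun F => by
    by_cases hF : FiniteDimensional ℝ F
    · obtain ⟨M, hM⟩ := exists_cofinite_orthogonal hε.1 F
      exact ⟨M, fun _ => hM⟩
    · exact ⟨⊥, fun h => absurd h hF⟩
  choose e he using hE
  choose m hm using hM
  let st : ℕ → Submodule ℝ X × Submodule ℝ X := fun k =>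
    Nat.rec (⊤, ⊥) (fun k s => (s.1 ⊓ m (s.2 ⊔ e k s.1), s.2 ⊔ e k s.1)) k
  have st_fst : ∀ k, (st (k + 1)).1 = (st k).1 ⊓ m (st (k + 1)).2 := fun k => rfl
  have st_snd : ∀ k, (st (k + 1)).2 = (st k).2 ⊔ e k (st k).1 := fun k => rfl
  have hfin : ∀ k, FiniteDimensional ℝ (X ⧸ (st k).1) ∧ FiniteDimensional ℝ (st k).2 := by
    intro k
    induction k with
    | zero =>
      exact ⟨Submodule.CoFG.top, inferInstanceAs (FiniteDimensional ℝ (⊥ : Submodule ℝ X))⟩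
    | succ k ih =>
      obtain ⟨h1, h2⟩ := ih
      have h3 : FiniteDimensional ℝ (e k (st k).1) :=
        Module.finite_of_finrank_pos (by rw [(he k _ h1).2.1]; positivity)
      have h4 : FiniteDimensional ℝ (st (k + 1)).2 := by
        rw [st_snd]; infer_instance
      refine ⟨?_, h4⟩
      rw [st_fst]
      exact Submodule.CoFG.inf h1 (hm _ h4).1
  have hsup : ∀ k, (Finset.range k).sup (fun j => e j (st j).1) = (st k).2 := by
    intro k
    induction k with
    | zero => rfl
    | succ k ih => rw [Finset.range_add_one, Finset.sup_insert, ih, st_snd, sup_comm]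
  refine ⟨fun k => e k (st k).1, fun k => (st k).1, rfl, fun k => (he k _ (hfin k).1).2.1,
    fun k => (hfin k).1, antitone_nat_of_succ_le fun k => (st_fst k).trans_le inf_le_left,
    fun k => (he k _ (hfin k).1).1, fun k => (he k _ (hfin k).1).2.2, fun k y hy g hg => ?_⟩
  rw [hsup] at hy
  exact (hm _ (hfin (k + 1)).2).2 y hy g ((st_fst k).le.trans inf_le_right hg)
end
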